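/- arXiv:0802.1094 — 5 statements merged into one kernel-verified Lean document; each statement's English description precedes it below -/
import Mathlib

section
/- Let t and n be natural numbers with t > 1 and n > 1. Then there exists a prime r dividing t^n − (−1)^n (as integers) that does not divide t^i − (−1)^i for any 1 ≤ i < n, except exactly in the following cases: (n,t) = (3,2), or n = 2 and t = 2^l + 1 for some l ≥ 0. -/
open Polynomial

namespace Polynomial

theorem abs_eval_cyclotomic_int_eq_prod_norm {n : ℕ} (hn : n ≠ 0) (a : ℤ) :
    ((|(cyclotomic n ℤ).eval a| : ℤ) : ℝ) = ∏ ζ ∈ primitiveRoots n ℂ, ‖(a : ℂ) - ζ‖ := by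
  have h : (((cyclotomic n ℤ).eval a : ℤ) : ℂ) = ∏ ζ ∈ primitiveRoots n ℂ, ((a : ℂ) - ζ) := by
    have := eval_intCast_map (Int.castRingHom ℂ) (cyclotomic n ℤ) a
    rw [map_cyclotomic, cyclotomic_eq_prod_X_sub_primitiveRoots
      (Complex.isPrimitiveRoot_exp n hn), eval_prod] at this
    simpa using this.symm
  rw [← norm_prod, ← h, Complex.norm_intCast, Int.cast_abs]

theorem abs_sub_one_pow_totient_le_abs_eval_cyclotomic {n : ℕ} (hn : n ≠ 0) {a : ℤ} (ha : a ≠ 0) :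
    (|a| - 1) ^ n.totient ≤ |(cyclotomic n ℤ).eval a| := by
  rw [← Int.cast_le (R := ℝ), abs_eval_cyclotomic_int_eq_prod_norm hn,
    ← Complex.card_primitiveRoots, Int.cast_pow, ← Finset.prod_const]
  have h1 : (1 : ℝ) ≤ |(a : ℝ)| := by exact_mod_cast Int.one_le_abs ha
  refine Finset.prod_le_prod (fun _ _ => by push_cast; linarith) fun ζ hζ => ?_
  have := norm_sub_norm_le (a : ℂ) ζ
  rw [((mem_primitiveRoots hn.bot_lt).1 hζ).norm'_eq_one hn, Complex.norm_intCast] at this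
  push_cast
  exact this

theorem abs_eval_cyclotomic_le_abs_add_one_pow_totient {n : ℕ} (hn : n ≠ 0) (a : ℤ) :
    |(cyclotomic n ℤ).eval a| ≤ (|a| + 1) ^ n.totient := by
  rw [← Int.cast_le (R := ℝ), abs_eval_cyclotomic_int_eq_prod_norm hn,
    ← Complex.card_primitiveRoots, Int.cast_pow, ← Finset.prod_const]
  refine Finset.prod_le_prod (fun _ _ => norm_nonneg _) fun ζ hζ => ?_
  have := norm_sub_le (a : ℂ) ζ
  rw [((mem_primitiveRoots hn.bot_lt).1 hζ).norm'_eq_one hn, Complex.norm_intCast] at this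
  push_cast
  exact this

theorem one_lt_abs_eval_cyclotomic {n : ℕ} (hn : 3 ≤ n) {a : ℤ} (ha : 2 ≤ |a|) :
    1 < |(cyclotomic n ℤ).eval a| := by
  have hn0 : n ≠ 0 := by lia
  rw [← Int.cast_lt (R := ℝ), abs_eval_cyclotomic_int_eq_prod_norm hn0, Int.cast_one,
    ← Finset.prod_const_one (s := primitiveRoots n ℂ)]
  refine Finset.prod_lt_prod_of_nonempty (fun _ _ => one_pos) (fun ζ hζ => ?_)
    ⟨_, (mem_primitiveRoots hn0.bot_lt).2 (Complex.isPrimitiveRoot_exp n hn0)⟩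
  have hζ := (mem_primitiveRoots hn0.bot_lt).1 hζ
  have ha' : (2 : ℝ) ≤ |(a : ℝ)| := by exact_mod_cast ha
  have h := norm_sub_norm_le (a : ℂ) ζ
  rw [hζ.norm'_eq_one hn0, Complex.norm_intCast] at h
  refine lt_of_le_of_ne (by linarith) fun heq => ?_
  have h1 := Complex.sq_norm ζ
  have h2 := Complex.sq_norm ((a : ℂ) - ζ)
  rw [hζ.norm'_eq_one hn0, Complex.normSq_apply] at h1
  rw [← heq, Complex.normSq_apply] at h2
  simp only [Complex.sub_re, Complex.sub_im, Complex.intCast_re, Complex.intCast_im] at h2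
  have him : ζ.im = 0 := by
    have ha0 : (a : ℝ) ≠ 0 := abs_pos.1 (by linarith)
    have hre : (a : ℝ) = 2 * ζ.re := mul_left_cancel₀ ha0 (by linarith)
    have hsq : (2 : ℝ) ^ 2 ≤ a ^ 2 := sq_le_sq.2 (by rwa [abs_two])
    rw [hre] at hsq
    nlinarith
  have hsq : ζ ^ 2 = 1 := by
    apply Complex.ext <;> simp [pow_two, him]
    nlinarith
  exact absurd (Nat.le_of_dvd two_pos (hζ.dvd_of_pow_eq_one 2 hsq)) (by lia)

end Polynomial

/-- A prime dividing `Φₙ(a)` divides `n` unless `a` has order `n` modulo that prime. -/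
theorem exists_isPrimitiveRoot_of_dvd_eval_cyclotomic {n p : ℕ} (hn : n ≠ 0) (hp : p.Prime)
    {a : ℤ} (h : (p : ℤ) ∣ (cyclotomic n ℤ).eval a) :
    ∃ k m : ℕ, n = p ^ k * m ∧ m ∣ p - 1 ∧ IsPrimitiveRoot (a : ZMod p) m := by
  have := Fact.mk hp
  obtain ⟨k, m, hm, rfl⟩ := Nat.exists_eq_pow_mul_and_not_dvd hn p hp.ne_one
  have : NeZero (m : ZMod p) := ⟨by rwa [Ne, ZMod.natCast_eq_zero_iff]⟩
  have hm0 : m ≠ 0 := by rintro rfl; simp at hm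
  have hroot : IsPrimitiveRoot (a : ZMod p) m := by
    rw [← isRoot_cyclotomic_prime_pow_mul_iff_of_charP (k := k) (p := p), IsRoot.def,
      ← map_cyclotomic _ (Int.castRingHom (ZMod p)), eval_intCast_map, eq_intCast,
      ZMod.intCast_zmod_eq_zero_iff_dvd]
    exact h
  refine ⟨k, m, rfl, ?_, hroot⟩
  rw [hroot.eq_orderOf]
  refine ZMod.orderOf_dvd_card_sub_one fun h0 => ?_
  rw [h0] at hroot
  have := hroot.pow_eq_one
  rw [zero_pow hm0] at this
  exact zero_ne_one this

theorem eval_cyclotomic_dvd_geom_sum {n d : ℕ} (hn : n ≠ 0) (hd : d ∣ n) (hdn : d < n) {a : ℤ}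
    (ha : 2 ≤ |a|) :
    (cyclotomic n ℤ).eval a ∣ ∑ i ∈ Finset.range (n / d), (a ^ d) ^ i := by
  have hd0 : d ≠ 0 := by rintro rfl; exact hn (zero_dvd_iff.1 hd)
  have h := eval_dvd (x := a)
    (X_pow_sub_one_mul_cyclotomic_dvd_X_pow_sub_one_of_dvd ℤ
      (Nat.mem_properDivisors.2 ⟨hd, hdn⟩))
  simp only [eval_mul, eval_sub, eval_pow, eval_X, eval_one] at h
  have hne : a ^ d - 1 ≠ 0 := fun h0 => by
    have h1 : |a| ^ d = 1 := by rw [← abs_pow, sub_eq_zero.1 h0, abs_one]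
    have := one_lt_pow₀ (show 1 < |a| by lia) hd0
    lia
  rw [← mul_dvd_mul_iff_left hne, mul_geom_sum, ← pow_mul, Nat.mul_div_cancel' hd]
  exact h

theorem not_sq_dvd_eval_cyclotomic {n p : ℕ} (hn : 3 ≤ n) (hp : p.Prime) (hpn : p ∣ n)
    {a : ℤ} (ha : 2 ≤ |a|) : ¬ (p : ℤ) ^ 2 ∣ (cyclotomic n ℤ).eval a := by
  intro hdvd
  have := Fact.mk hp
  have hn0 : n ≠ 0 := by lia
  obtain ⟨k, m, rfl, hm, hroot⟩ := exists_isPrimitiveRoot_of_dvd_eval_cyclotomic hn0 hp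
    ((dvd_pow_self _ two_ne_zero).trans hdvd)
  have hp1 : 0 < p - 1 := by have := hp.two_le; lia
  have hk : k ≠ 0 := by
    rintro rfl
    have := Nat.le_of_dvd hp1 (hpn.trans (by simpa using hm))
    lia
  obtain ⟨j, rfl⟩ := Nat.exists_eq_succ_of_ne_zero hk
  have hm0 : 0 < m := Nat.pos_of_dvd_of_pos hm hp1
  have hd0 : 0 < p ^ j * m := Nat.mul_pos (pow_pos hp.pos _) hm0
  have heq : p ^ (j + 1) * m = p * (p ^ j * m) := by ring
  have hgeom := hdvd.trans (eval_cyclotomic_dvd_geom_sum (d := p ^ j * m) hn0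
    (heq ▸ dvd_mul_left _ _) (by rw [Nat.succ_eq_add_one, heq]; exact lt_mul_left hd0 hp.one_lt) ha)
  rw [Nat.succ_eq_add_one, heq, Nat.mul_div_cancel _ hd0] at hgeom
  rcases hp.eq_two_or_odd' with rfl | hodd
  · obtain rfl : m = 1 := by simpa using hm
    have hj : j ≠ 0 := by rintro rfl; simp at hn
    obtain ⟨i, rfl⟩ := Nat.exists_eq_succ_of_ne_zero hj
    rw [Finset.sum_range_succ, Finset.sum_range_one, pow_zero, pow_one, mul_one,
      Nat.succ_eq_add_one, pow_succ 2 i, pow_mul] at hgeom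
    generalize a ^ 2 ^ i = b at hgeom
    obtain ⟨c, hc⟩ := hgeom
    rcases Int.even_or_odd' b with ⟨e, rfl | rfl⟩ <;> push_cast at hc <;> ring_nf at hc <;> lia
  · have hb : (p : ℤ) ∣ a ^ (p ^ j * m) - 1 := by
      rw [← ZMod.intCast_zmod_eq_zero_iff_dvd]
      push_cast
      rw [mul_comm, pow_mul, hroot.pow_eq_one, one_pow, sub_self]
    have hpz : Prime (p : ℤ) := Nat.prime_iff_prime_int.1 hp
    have hnb : ¬ (p : ℤ) ∣ a ^ (p ^ j * m) := fun h => hpz.not_isUnit (isUnit_of_dvd_one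
      (by simpa using dvd_sub h hb))
    have h1 := emultiplicity_geom_sum₂_eq_one hpz hodd hb hnb
    simp only [one_pow, mul_one] at h1
    have := le_emultiplicity_of_pow_dvd hgeom
    rw [h1] at this
    exact absurd this (by norm_num)

theorem Nat.Prime.lt_abs_eval_cyclotomic {p m k : ℕ} (hp : p.Prime) (hk : k ≠ 0)
    (hm : m ∣ p - 1) (hn : 3 ≤ p ^ k * m) {a : ℤ} (ha : 2 ≤ |a|)
    (h3 : ¬ (p ^ k * m = 3 ∧ a = -2)) (h6 : ¬ (p ^ k * m = 6 ∧ a = 2)) :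
    (p : ℤ) < |(cyclotomic (p ^ k * m) ℤ).eval a| := by
  have hp2 := hp.two_le
  have hm0 : 0 < m := Nat.pos_of_dvd_of_pos hm (by lia)
  have hpm : ¬ p ∣ m := fun h => absurd (Nat.le_of_dvd (by lia) (h.trans hm)) (by lia)
  have ha0 : a ≠ 0 := by rintro rfl; simp at ha
  have le_totient : ∀ {d : ℕ}, 0 < d → p ∣ d → p - 1 ≤ d.totient := fun hd h => by
    have := Nat.le_of_dvd (Nat.totient_pos.2 hd) (Nat.totient_dvd_of_dvd h)
    rwa [Nat.totient_prime hp] at this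
  have hpow : p ≤ 2 ^ (p - 1) := by
    have := Nat.lt_two_pow_self (n := p - 1)
    lia
  obtain ⟨j, rfl⟩ := Nat.exists_eq_succ_of_ne_zero hk
  rcases Nat.eq_zero_or_pos j with rfl | hj
  · simp only [Nat.succ_eq_add_one, zero_add, pow_one] at *
    have hp3 : 3 ≤ p := by
      rcases hp2.lt_or_eq with h | rfl
      · exact h
      · have := Nat.le_of_dvd (by lia) hm
        lia
    rcases ha.lt_or_eq with ha3 | ha2
    · have h1 := abs_sub_one_pow_totient_le_abs_eval_cyclotomic (n := p * m) (by lia) ha0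
      have h2 : (2 : ℤ) ^ (p - 1) ≤ (|a| - 1) ^ (p * m).totient :=
        (pow_le_pow_right₀ (by lia) (le_totient (by lia) (dvd_mul_right _ _))).trans
          (pow_le_pow_left₀ (by lia) (by lia) _)
      have h4 : p < 2 ^ (p - 1) := by
        obtain ⟨q, rfl⟩ := Nat.exists_eq_add_of_le' hp3
        have := Nat.lt_two_pow_self (n := q + 1)
        rw [show q + 3 - 1 = q + 1 + 1 by lia, pow_succ]
        lia
      have h5 : (p : ℤ) < 2 ^ (p - 1) := by exact_mod_cast h4
      lia
    · rcases hp3.lt_or_eq with hp4 | rfl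
      · have hexp := congrArg (eval a) (cyclotomic_expand_eq_cyclotomic_mul hp hpm ℤ)
        rw [expand_eval, eval_mul, mul_comm m p] at hexp
        have hlow := abs_sub_one_pow_totient_le_abs_eval_cyclotomic hm0.ne' (pow_ne_zero p ha0)
        have hup := abs_eval_cyclotomic_le_abs_add_one_pow_totient hm0.ne' a
        rw [hexp, abs_mul, abs_pow, ← ha2] at hlow
        rw [← ha2] at hup
        by_contra! hle
        have h1 : ((2 : ℤ) ^ p - 1) ^ m.totient ≤ p * 3 ^ m.totient :=
          hlow.trans (mul_le_mul hle hup (abs_nonneg _) (by lia))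
        have h2 : (p : ℤ) * 3 < 2 ^ p - 1 := by
          have : ∀ q : ℕ, (q + 4) * 3 + 1 < 2 ^ (q + 4) := fun q => by
            induction q with
            | zero => norm_num
            | succ q ih => rw [show q + 1 + 4 = q + 4 + 1 by lia, pow_succ]; lia
          have := this (p - 4)
          rw [Nat.sub_add_cancel hp4] at this
          zify at this
          lia
        have hφ := (Nat.totient_pos.2 hm0).ne'
        have h4 := pow_lt_pow_left₀ h2 (by lia) hφ
        have h5 : (p : ℤ) * 3 ^ m.totient ≤ (p * 3) ^ m.totient := by
          rw [mul_pow]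
          exact mul_le_mul_of_nonneg_right (le_self_pow₀ (by lia) hφ) (by positivity)
        lia
      · have hm2 : m ≤ 2 := Nat.le_of_dvd two_pos hm
        rcases (abs_eq (by lia)).1 ha2.symm with rfl | rfl <;> interval_cases m <;>
          first
          | exact absurd ⟨rfl, rfl⟩ h3
          | exact absurd ⟨rfl, rfl⟩ h6
          | norm_num [cyclotomic_three, cyclotomic_six]
  · have hd0 : 0 < p ^ j * m := Nat.mul_pos (pow_pos hp.pos _) hm0
    have hpd : p ∣ p ^ j * m := dvd_mul_of_dvd_left (dvd_pow_self _ hj.ne') _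
    have hexp := congrArg (eval a) (cyclotomic_expand_eq_cyclotomic hp hpd ℤ)
    rw [expand_eval, show p ^ j * m * p = p ^ (j + 1) * m by ring] at hexp
    rw [Nat.succ_eq_add_one, ← hexp]
    have h4 : (4 : ℤ) ≤ |a ^ p| := by
      rw [abs_pow]
      exact (show (4 : ℤ) ≤ |a| ^ 2 by nlinarith).trans (pow_le_pow_right₀ (by lia) hp2)
    have h1 := abs_sub_one_pow_totient_le_abs_eval_cyclotomic hd0.ne' (pow_ne_zero p ha0)
    have h2 : (3 : ℤ) ^ (p - 1) ≤ (|a ^ p| - 1) ^ (p ^ j * m).totient :=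
      (pow_le_pow_right₀ (by lia) (le_totient hd0 hpd)).trans
        (pow_le_pow_left₀ (by lia) (by lia) _)
    have h5 : (2 : ℤ) ^ (p - 1) < 3 ^ (p - 1) :=
      pow_lt_pow_left₀ (by lia) (by lia) (by lia)
    have h6 : (p : ℤ) ≤ 2 ^ (p - 1) := by exact_mod_cast hpow
    lia

/-- **Zsigmondy's theorem** for `aⁿ - 1`, with `a` an integer of either sign and `n ≥ 3`. -/
theorem exists_prime_isPrimitiveRoot_zmod {n : ℕ} (hn : 3 ≤ n) {a : ℤ} (ha : 2 ≤ |a|)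
    (h3 : ¬ (n = 3 ∧ a = -2)) (h6 : ¬ (n = 6 ∧ a = 2)) :
    ∃ r : ℕ, r.Prime ∧ IsPrimitiveRoot (a : ZMod r) n := by
  by_contra! hcon
  have hn0 : n ≠ 0 := by lia
  set N := ((cyclotomic n ℤ).eval a).natAbs with hN
  have eq_pow_mul_of_dvd : ∀ p : ℕ, p.Prime → p ∣ N →
      ∃ k m : ℕ, n = p ^ k * m ∧ k ≠ 0 ∧ m ∣ p - 1 := fun p hp hpN => by
    obtain ⟨k, m, hkm, hm, hroot⟩ :=
      exists_isPrimitiveRoot_of_dvd_eval_cyclotomic hn0 hp (Int.natCast_dvd.2 hpN)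
    refine ⟨k, m, hkm, ?_, hm⟩
    rintro rfl
    rw [pow_zero, one_mul] at hkm
    exact hcon p hp (hkm ▸ hroot)
  have le_of_dvd : ∀ p q : ℕ, p.Prime → q.Prime → p ∣ N → q ∣ N → q ≤ p :=
      fun p q hp hq hpN hqN => by
    obtain ⟨k, m, hkm, -, hm⟩ := eq_pow_mul_of_dvd p hp hpN
    obtain ⟨l, m', hlm, hl, -⟩ := eq_pow_mul_of_dvd q hq hqN
    have hqn : q ∣ p ^ k * m := hkm ▸ hlm ▸ dvd_mul_of_dvd_left (dvd_pow_self _ hl) _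
    rcases hq.dvd_mul.1 hqn with h | h
    · exact Nat.le_of_dvd hp.pos (hq.dvd_of_dvd_pow h)
    · have := Nat.le_of_dvd (by have := hp.two_le; lia) (h.trans hm)
      lia
  have hN1 : 1 < N := by
    have := one_lt_abs_eval_cyclotomic hn ha
    rw [Int.abs_eq_natAbs] at this
    exact_mod_cast this
  obtain ⟨p, hp, hpN⟩ := Nat.exists_prime_and_dvd hN1.ne'
  obtain ⟨k, m, rfl, hk, hm⟩ := eq_pow_mul_of_dvd p hp hpN
  have hpow := Nat.eq_prime_pow_of_unique_prime_dvd (by lia : N ≠ 0) fun {q} hq hqN =>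
    le_antisymm (le_of_dvd p q hp hq hpN hqN) (le_of_dvd q p hq hp hqN hpN)
  have hlt := hp.lt_abs_eval_cyclotomic hk hm hn ha h3 h6
  rw [Int.abs_eq_natAbs, Nat.cast_lt, ← hN] at hlt
  have hsq := not_sq_dvd_eval_cyclotomic hn hp (dvd_mul_of_dvd_left (dvd_pow_self _ hk) _) ha
  have hlen : N.primeFactorsList.length < 2 := by
    by_contra! h
    refine hsq ?_
    rw [← Nat.cast_pow, Int.natCast_dvd, ← hN, hpow]
    exact pow_dvd_pow p h
  have hle : N ≤ p := by
    rw [hpow]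
    exact (Nat.pow_le_pow_right hp.pos (Nat.lt_succ_iff.1 hlen)).trans_eq (pow_one p)
  lia

theorem exists_prime_dvd_sq_sub_one_not_dvd_add_one_iff {t : ℕ} (ht : 1 < t) :
    (∃ r : ℕ, r.Prime ∧ (r : ℤ) ∣ (t : ℤ) ^ 2 - 1 ∧ ¬ (r : ℤ) ∣ (t : ℤ) + 1) ↔
      ¬ ∃ l : ℕ, t = 2 ^ l + 1 := by
  have hfac : (t : ℤ) ^ 2 - 1 = (t + 1) * (t - 1) := by ring
  constructor
  · rintro ⟨r, hr, hdvd, hndvd⟩ ⟨l, rfl⟩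
    rw [hfac] at hdvd
    have h := ((Nat.prime_iff_prime_int.1 hr).dvd_or_dvd hdvd).resolve_left hndvd
    push_cast at h
    rw [add_sub_cancel_right] at h
    have h2 : r ∣ 2 ^ l := by exact_mod_cast h
    obtain rfl := (Nat.prime_dvd_prime_iff_eq hr Nat.prime_two).1 (hr.dvd_of_dvd_pow h2)
    refine hndvd ?_
    push_cast
    rw [add_assoc]
    exact dvd_add h (by norm_num)
  · intro h
    rcases Nat.eq_two_pow_or_exists_odd_prime_and_dvd (t - 1) with ⟨l, hl⟩ | ⟨r, hr, hrt, hodd⟩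
    · exact absurd ⟨l, by lia⟩ h
    · have hrt' : (r : ℤ) ∣ (t : ℤ) - 1 := by
        have := Int.natCast_dvd_natCast.2 hrt
        rwa [Nat.cast_sub ht.le, Nat.cast_one] at this
      refine ⟨r, hr, hfac ▸ dvd_mul_of_dvd_right hrt' _, fun h1 => ?_⟩
      have h2 : (r : ℤ) ∣ 2 := by
        have := dvd_sub h1 hrt'
        rwa [show (t : ℤ) + 1 - (t - 1) = 2 by ring] at this
      have h3 : r ∣ 2 := by exact_mod_cast h2
      rw [(Nat.prime_dvd_prime_iff_eq hr Nat.prime_two).1 h3] at hodd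
      exact absurd hodd (by decide)

/-- A Zsigmondy-type theorem for `t^n - (-1)^n`: for `t, n > 1` there is a prime dividing
`t^n - (-1)^n` and none of `t^i - (-1)^i` for `1 ≤ i < n`, except exactly when
`(n,t) = (3,2)` or `n = 2` and `t = 2^l + 1` for some `l ≥ 0`. -/
theorem exists_primitive_prime_divisor_minus_iff (t n : ℕ) (ht : 1 < t) (hn : 1 < n) :
    (∃ r : ℕ, r.Prime ∧ (r : ℤ) ∣ (t : ℤ) ^ n - (-1) ^ n ∧
        ∀ i : ℕ, 1 ≤ i → i < n → ¬ (r : ℤ) ∣ (t : ℤ) ^ i - (-1) ^ i) ↔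
      ¬ ((n = 3 ∧ t = 2) ∨ (n = 2 ∧ ∃ l : ℕ, t = 2 ^ l + 1)) := by
  have ht0 : (2 : ℤ) ≤ |-(t : ℤ)| := by rw [abs_neg, Nat.abs_cast]; lia
  rcases (show 2 ≤ n from hn).eq_or_lt with rfl | hn3
  · have h := exists_prime_dvd_sq_sub_one_not_dvd_add_one_iff ht
    simp only [Nat.reduceEqDiff, false_and, true_and, false_or]
    rw [← h]
    refine exists_congr fun r => and_congr_right fun _ => and_congr (by norm_num) ?_
    constructor
    · intro hi
      simpa using hi 1 le_rfl one_lt_two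
    · intro hr i hi1 hi2
      obtain rfl : i = 1 := by lia
      simpa using hr
  constructor
  · rintro ⟨r, hr, hdvd, hndvd⟩ (⟨rfl, rfl⟩ | ⟨rfl, -⟩)
    · have h9 : r ∣ 3 ^ 2 := by
        norm_num at hdvd
        exact_mod_cast hdvd
      obtain rfl := (Nat.prime_dvd_prime_iff_eq hr Nat.prime_three).1 (hr.dvd_of_dvd_pow h9)
      exact hndvd 1 le_rfl (by norm_num) (by norm_num)
    · lia
  · intro h
    obtain ⟨r, hr, hroot⟩ := exists_prime_isPrimitiveRoot_zmod (n := n) hn3 ht0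
      (fun h' => h (Or.inl ⟨h'.1, by lia⟩)) (by lia)
    have key : ∀ i : ℕ, (r : ℤ) ∣ (t : ℤ) ^ i - (-1) ^ i ↔ ((-(t : ℤ) : ℤ) : ZMod r) ^ i = 1 := by
      intro i
      rw [← ZMod.intCast_zmod_eq_zero_iff_dvd]
      push_cast
      rw [neg_pow (t : ZMod r), sub_eq_zero]
      rcases neg_one_pow_eq_or (ZMod r) i with h1 | h1 <;> rw [h1]
      · rw [one_mul]
      · rw [neg_one_mul, neg_eq_iff_eq_neg]
    refine ⟨r, hr, (key n).2 hroot.pow_eq_one, fun i hi hin hd => ?_⟩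
    exact hroot.pow_ne_one_of_pos_of_lt (by lia) hin ((key i).1 hd)
end

section
/- Let n ≥ 2 be a natural number and u an integer with |u| ≥ 2, and set d = gcd(n, u − 1) (a positive integer). Then d·(u − 1) divides u^n − 1 and d divides u^{n−1} − 1, and the integers (u^n − 1)/(d·(u − 1)) and (u^{n−1} − 1)/d are coprime. -/
/-- The geometric sum `1 + u + ⋯ + u ^ (n - 1)` is congruent to `n` modulo `u - 1`. -/
theorem sub_one_dvd_geom_sum_sub_natCast (u : ℤ) (n : ℕ) :
    u - 1 ∣ ∑ i ∈ Finset.range n, u ^ i - n := by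
  have h : ∑ i ∈ Finset.range n, u ^ i - n = ∑ i ∈ Finset.range n, (u ^ i - 1) := by
    simp [Finset.sum_sub_distrib]
  rw [h]
  exact Finset.dvd_sum fun i _ => sub_one_dvd_pow_sub_one u i

/-- For `n ≥ 2` and an integer `u` with `|u| ≥ 2`, setting `d = gcd(n, u-1)`, the products
`d(u-1)` and `d` divide `u^n - 1` and `u^{n-1} - 1` respectively, and the corresponding
quotients are coprime. -/
theorem coprime_quotients_of_gcd (n : ℕ) (hn : 2 ≤ n) (u : ℤ) (hu : 2 ≤ |u|)
    (d : ℤ) (hd : d = Int.gcd (n : ℤ) (u - 1)) :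
    d * (u - 1) ∣ u ^ n - 1 ∧ d ∣ u ^ (n - 1) - 1 ∧
      IsCoprime ((u ^ n - 1) / (d * (u - 1))) ((u ^ (n - 1) - 1) / d) := by
  have hw : u - 1 ≠ 0 := by
    intro h
    obtain rfl : u = 1 := by omega
    norm_num at hu
  have hd0 : d ≠ 0 := by
    rw [hd]
    exact_mod_cast (Int.gcd_pos_of_ne_zero_right _ hw).ne'
  have hdn : d ∣ n := hd ▸ Int.gcd_dvd_left _ _
  have hdw : d ∣ u - 1 := hd ▸ Int.gcd_dvd_right _ _
  have bezout := Int.gcd_eq_gcd_ab n (u - 1)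
  rw [← hd] at bezout
  have hS := geom_sum_mul u n
  obtain ⟨K, hK⟩ := sub_one_dvd_geom_sum_sub_natCast u n
  generalize ∑ i ∈ Finset.range n, u ^ i = S at hS hK
  have hSn : S = n + (u - 1) * K := by linarith
  obtain ⟨S', rfl⟩ : d ∣ S := hSn ▸ dvd_add hdn (hdw.mul_right K)
  have hdT : d ∣ u ^ (n - 1) - 1 := hdw.trans (sub_one_dvd_pow_sub_one u _)
  obtain ⟨T', hT⟩ := id hdT
  have hpow : u ^ n = u * u ^ (n - 1) := (mul_pow_sub_one (by omega) u).symm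
  have hSw : u ^ n - 1 = d * (u - 1) * S' := by linear_combination -hS
  refine ⟨⟨S', hSw⟩, hdT, ?_⟩
  rw [hSw, hT, Int.mul_ediv_cancel_left _ (mul_ne_zero hd0 hw), Int.mul_ediv_cancel_left _ hd0]
  set a := Int.gcdA n (u - 1)
  set b := Int.gcdB n (u - 1)
  have hw_comb : u - 1 = (u - 1) * (d * S') - u * (d * T') := by
    linear_combination hSw - hpow - u * hT
  refine ⟨a + (b - a * K) * (u - 1), -(b - a * K) * u, mul_left_cancel₀ hd0 ?_⟩
  linear_combination a * hSn - (b - a * K) * hw_comb - bezout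
end

section
/- Let L = PSL_n(q) be simple (i.e., (n,q) is not (2,2) or (2,3)), let d = gcd(n, q − 1), and set a₁ = (q^n − 1)/(d·(q − 1)) and a₂ = (q^{n−1} − 1)/d. Then a₁ and a₂ are coprime, both a₁ and a₂ are orders of elements of L, and each is maximal under divisibility in the spectrum of L: for every g ∈ L, if a₁ divides the order of g then the order of g equals a₁, and if a₂ divides the order of g then the order of g equals a₂. -/
open Polynomial

theorem Nat.gcd_lcm_distrib_left {a b c : ℕ} (ha : a ≠ 0) (hb : b ≠ 0) (hc : c ≠ 0) :
    a.gcd (b.lcm c) = (a.gcd b).lcm (a.gcd c) := by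
  have hab := Nat.gcd_ne_zero_left (n := b) ha
  have hac := Nat.gcd_ne_zero_left (n := c) ha
  refine Nat.eq_of_factorization_eq (Nat.gcd_ne_zero_left ha) (Nat.lcm_ne_zero hab hac) fun p => ?_
  rw [Nat.factorization_gcd ha (Nat.lcm_ne_zero hb hc), Nat.factorization_lcm hb hc,
    Nat.factorization_lcm hab hac, Nat.factorization_gcd ha hb, Nat.factorization_gcd ha hc,
    Finsupp.inf_apply, Finsupp.sup_apply, Finsupp.sup_apply, Finsupp.inf_apply, Finsupp.inf_apply,
    inf_sup_left]

theorem Finset.gcd_lcm_dvd {ι : Type*} (s : Finset ι) (f : ι → ℕ) {a M : ℕ} (ha : a ≠ 0)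
    (hf : ∀ k ∈ s, f k ≠ 0) (h : ∀ k ∈ s, a.gcd (f k) ∣ M) : a.gcd (s.lcm f) ∣ M := by
  classical
  induction s using Finset.induction_on with
  | empty => simp
  | insert k s hk ih =>
    rw [Finset.lcm_insert, lcm_eq_nat_lcm, Nat.gcd_lcm_distrib_left ha (hf k (by simp))]
    · exact Nat.lcm_dvd (h k (by simp))
        (ih (fun j hj => hf j (by simp [hj])) fun j hj => h j (by simp [hj]))
    · rw [Ne, Finset.lcm_eq_zero_iff]
      rintro ⟨j, hj, hj0⟩
      exact hf j (by simp [Finset.mem_coe.1 hj]) hj0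

/-- A divisor of `q ^ n - 1` that also divides the least common multiple of the `q ^ k - 1` with
`1 ≤ k < n` divides the quotient of `q ^ n - 1` by the value at `q` of the `n`-th cyclotomic
polynomial. -/
theorem mul_eval_cyclotomic_dvd_pow_sub_one {a n r q : ℕ} (hq : 2 ≤ q) (hn : 0 < n) (hr : r ≤ n)
    (ha : a ∣ q ^ n - 1) (hL : a ∣ (Finset.Ico 1 r).lcm fun k => q ^ k - 1) :
    (a : ℤ) * (cyclotomic n ℤ).eval (q : ℤ) ∣ (q : ℤ) ^ n - 1 := by
  have hpow : ∀ {k}, 0 < k → q ^ k - 1 ≠ 0 := fun {k} hk =>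
    (Nat.sub_pos_of_lt (Nat.one_lt_pow hk.ne' hq)).ne'
  have ha0 : a ≠ 0 := fun h => hpow hn (by simpa [h] using ha)
  obtain ⟨M, hM⟩ := map_dvd (evalRingHom (q : ℤ)) (cyclotomic.dvd_X_pow_sub_one n ℤ)
  simp only [coe_evalRingHom, eval_sub, eval_pow, eval_X, eval_one] at hM
  have hΦ : (cyclotomic n ℤ).eval (q : ℤ) ≠ 0 :=
    (cyclotomic_pos_and_nonneg n (q : ℤ)).1 (by exact_mod_cast hq) |>.ne'
  have key : a.gcd ((Finset.Ico 1 r).lcm fun k => q ^ k - 1) ∣ M.natAbs := by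
    refine Finset.gcd_lcm_dvd _ _ ha0 (fun k hk => hpow (Finset.mem_Ico.1 hk).1) fun k hk => ?_
    rw [Finset.mem_Ico] at hk
    refine (Nat.gcd_dvd_gcd_of_dvd_left _ ha).trans ?_
    rw [Nat.pow_sub_one_gcd_pow_sub_one]
    have hmem : n.gcd k ∈ n.properDivisors :=
      Nat.mem_properDivisors.2 ⟨Nat.gcd_dvd_left _ _,
        (Nat.le_of_dvd hk.1 (Nat.gcd_dvd_right n k)).trans_lt (hk.2.trans_le hr)⟩
    have hdvd := map_dvd (evalRingHom (q : ℤ))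
      (X_pow_sub_one_mul_cyclotomic_dvd_X_pow_sub_one_of_dvd ℤ hmem)
    simp only [coe_evalRingHom, eval_sub, eval_pow, eval_X, eval_one, eval_mul] at hdvd
    rw [hM, mul_comm, mul_dvd_mul_iff_left hΦ] at hdvd
    rw [← Int.natCast_dvd, Nat.cast_sub (Nat.one_le_pow _ _ (by omega))]
    exact_mod_cast hdvd
  rw [Nat.gcd_eq_left hL, ← Int.natCast_dvd] at key
  rw [hM, mul_comm]
  exact mul_dvd_mul_left _ key

theorem sub_one_pow_totient_lt_eval_cyclotomic {n q : ℕ} (hn : 2 ≤ n) (hq : 2 ≤ q) :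
    ((q : ℤ) - 1) ^ n.totient < (cyclotomic n ℤ).eval (q : ℤ) := by
  have h := sub_one_pow_totient_lt_cyclotomic_eval hn (q := (q : ℝ)) (by exact_mod_cast hq)
  have h2 : eval (q : ℝ) (cyclotomic n ℝ) = (((cyclotomic n ℤ).eval (q : ℤ) : ℤ) : ℝ) := by
    rw [← map_cyclotomic_int, ← Int.cast_natCast q, eval_intCast_map]
    simp
  rw [h2] at h
  exact_mod_cast h

theorem not_eval_cyclotomic_dvd_gcd {n d q : ℕ} (hn : 2 ≤ n) (hq : 2 ≤ q) (hd : d ∣ q - 1) :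
    ¬ (cyclotomic n ℤ).eval (q : ℤ) ∣ d := by
  intro h
  have hd0 : 0 < d := Nat.pos_of_dvd_of_pos hd (by omega)
  have h1 := Int.le_of_dvd (by exact_mod_cast hd0) h
  have h2 := sub_one_pow_totient_lt_eval_cyclotomic hn hq
  have h3 : (q : ℤ) - 1 ≤ ((q : ℤ) - 1) ^ n.totient :=
    le_self_pow₀ (by omega) (Nat.totient_pos.2 (by omega)).ne'
  have h4 := Nat.le_of_dvd (by omega) hd
  omega

theorem not_eval_cyclotomic_dvd_gcd_mul {n q : ℕ} (hn : 2 ≤ n) (hq : 2 ≤ q)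
    (h22 : ¬ (n = 2 ∧ q = 2)) (h23 : ¬ (n = 2 ∧ q = 3)) :
    ¬ (cyclotomic n ℤ).eval (q : ℤ) ∣ (n.gcd (q - 1) : ℤ) * (q - 1) := by
  intro h
  have hd0 : 0 < n.gcd (q - 1) := Nat.gcd_pos_of_pos_left _ (by omega)
  have hdq : n.gcd (q - 1) ≤ q - 1 := Nat.le_of_dvd (by omega) (Nat.gcd_dvd_right _ _)
  have hpos : (0 : ℤ) < (n.gcd (q - 1) : ℤ) * (q - 1) := by
    apply mul_pos <;> omega
  have h1 := Int.le_of_dvd hpos h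
  rcases hn.eq_or_lt with rfl | hn3
  · simp only [cyclotomic_two, eval_add, eval_X, eval_one] at h h1
    have hd2 : Nat.gcd 2 (q - 1) ∣ 2 := Nat.gcd_dvd_left _ _
    rcases (Nat.dvd_prime Nat.prime_two).1 hd2 with hd | hd <;> rw [hd] at h h1
    · push_cast at h1
      omega
    · have h4 : (q : ℤ) + 1 ∣ 4 := by
        have : (4 : ℤ) = 2 * (q + 1) - (2 : ℕ) * (q - 1) := by push_cast; ring
        rw [this]
        exact dvd_sub (dvd_mul_left _ _) h
      have h5 := Int.le_of_dvd (by norm_num) h4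
      omega
  · have h2 := sub_one_pow_totient_lt_eval_cyclotomic hn hq
    have h3 : ((q : ℤ) - 1) ^ 2 ≤ ((q : ℤ) - 1) ^ n.totient := by
      refine pow_le_pow_right₀ (by omega) ?_
      have := Nat.totient_pos.2 (show 0 < n by omega)
      have h' : n.totient ≠ 1 := fun h' => by
        rcases Nat.totient_eq_one_iff.1 h' with h' | h' <;> omega
      omega
    have h4 : ((n.gcd (q - 1) : ℕ) : ℤ) ≤ q - 1 := by omega
    nlinarith

theorem geomSum_modEq (q n : ℕ) (hq : 1 ≤ q) :
    ∑ i ∈ Finset.range n, q ^ i ≡ n [MOD q - 1] := by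
  have h1 : q ≡ 1 [MOD q - 1] := ((Nat.modEq_iff_dvd' hq).2 dvd_rfl).symm
  induction n with
  | zero => rfl
  | succ n ih =>
    rw [Finset.sum_range_succ]
    simpa using ih.add (h1.pow n)

theorem gcd_geomSum (q n : ℕ) (hq : 1 ≤ q) :
    (∑ i ∈ Finset.range n, q ^ i).gcd (q - 1) = n.gcd (q - 1) :=
  (geomSum_modEq q n hq).gcd_eq

theorem geomSum_mul_sub_one (q n : ℕ) (hq : 1 ≤ q) :
    (∑ i ∈ Finset.range n, q ^ i) * (q - 1) = q ^ n - 1 := by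
  have := geom_sum_mul_add (q - 1) n
  rw [Nat.sub_add_cancel hq] at this
  omega

theorem gcd_one_add_geomSum (q n : ℕ) (hq : 1 ≤ q) :
    (1 + ∑ i ∈ Finset.range n, q ^ i).gcd (q ^ n - 1) = (n + 1).gcd (q - 1) := by
  rw [← geomSum_mul_sub_one q n hq, Nat.Coprime.gcd_mul_left_cancel_right]
  · exact Nat.ModEq.gcd_eq (by simpa [add_comm] using (geomSum_modEq q n hq).add_left 1)
  · simp

theorem exists_dvd_pow_of_forall_irreducible_dvd {α : Type*} [CommMonoidWithZero α]
    [WfDvdMonoid α] {f h : α} (hf : f ≠ 0)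
    (hfh : ∀ g, Irreducible g → g ∣ f → g ∣ h) : ∃ N : ℕ, f ∣ h ^ N := by
  induction f using WfDvdMonoid.induction_on_irreducible with
  | zero => exact absurd rfl hf
  | unit u hu => exact ⟨0, hu.dvd⟩
  | mul a i ha hi ih =>
    obtain ⟨N, hN⟩ := ih ha fun g hg hga => hfh g hg (hga.mul_left i)
    exact ⟨N + 1, pow_succ' h N ▸ mul_dvd_mul (hfh i hi (dvd_mul_right i a)) hN⟩

namespace Matrix.ProjectiveSpecialLinearGroup

variable {ι : Type*} [DecidableEq ι] [Fintype ι] {F : Type*}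

theorem mk_pow_eq_one_iff [CommRing F] (A : SpecialLinearGroup ι F) (k : ℕ) :
    (A : ProjectiveSpecialLinearGroup ι F) ^ k = 1 ↔
      ∃ r : F, (A : Matrix ι ι F) ^ k = algebraMap F (Matrix ι ι F) r := by
  rw [← QuotientGroup.mk_pow, QuotientGroup.eq_one_iff, SpecialLinearGroup.mem_center_iff]
  constructor
  · rintro ⟨r, -, hr⟩
    exact ⟨r, by rw [← SpecialLinearGroup.coe_pow, ← hr]; rfl⟩
  · rintro ⟨r, hr⟩
    have hr' : scalar ι r = ((A ^ k : SpecialLinearGroup ι F) : Matrix ι ι F) := by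
      rw [SpecialLinearGroup.coe_pow, hr]; rfl
    refine ⟨r, ?_, hr'⟩
    have := congrArg det hr'
    simpa using this

theorem orderOf_mk_dvd [CommRing F] (A : SpecialLinearGroup ι F) {k : ℕ} {c : F}
    (h : (A : Matrix ι ι F).charpoly ∣ X ^ k - C c) :
    orderOf (A : ProjectiveSpecialLinearGroup ι F) ∣ k := by
  rw [orderOf_dvd_iff_pow_eq_one, mk_pow_eq_one_iff]
  refine ⟨c, ?_⟩
  obtain ⟨g, hg⟩ := h
  have := congrArg (aeval (A : Matrix ι ι F)) hg
  rw [map_mul, aeval_self_charpoly, zero_mul] at this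
  simpa [sub_eq_zero] using this

theorem coeff_zero_charpoly [CommRing F] (A : SpecialLinearGroup ι F) :
    (-1) ^ Fintype.card ι * (A : Matrix ι ι F).charpoly.coeff 0 = 1 := by
  rw [← det_eq_sign_charpoly_coeff, A.det_coe]

variable [Field F] [Fintype F]

theorem dvd_lcm_of_dvd_orderOf_mk {p : ℕ} [Fact p.Prime] [CharP F p]
    (A : SpecialLinearGroup ι F) {r : ℕ}
    (hA : ∀ g : F[X], Irreducible g → g ∣ (A : Matrix ι ι F).charpoly → g.natDegree < r)
    {a : ℕ} (hap : a.Coprime p) (ha : a ∣ orderOf (A : ProjectiveSpecialLinearGroup ι F)) :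
    a ∣ (Finset.Ico 1 r).lcm fun k => Fintype.card F ^ k - 1 := by
  set L := (Finset.Ico 1 r).lcm fun k => Fintype.card F ^ k - 1
  obtain ⟨N, hN⟩ : ∃ N : ℕ, (A : Matrix ι ι F).charpoly ∣ (X ^ L - 1) ^ N := by
    refine exists_dvd_pow_of_forall_irreducible_dvd (charpoly_monic _).ne_zero fun g hg hgA => ?_
    have h1 := hg.natDegree_dvd_iff_dvd_X_pow_card_pow_sub_X.1 dvd_rfl
    rw [Nat.card_eq_fintype_card] at h1
    have hpos : 0 < Fintype.card F ^ g.natDegree := pow_pos Fintype.card_pos _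
    rw [show (X : F[X]) ^ Fintype.card F ^ g.natDegree - X =
      X * (X ^ (Fintype.card F ^ g.natDegree - 1) - 1) by
        rw [mul_sub, mul_one, ← pow_succ', Nat.sub_add_cancel hpos]] at h1
    rcases hg.prime.dvd_or_dvd h1 with h2 | h2
    · have h3 : (X : F[X]) ∣ (A : Matrix ι ι F).charpoly :=
        ((hg.associated_of_dvd irreducible_X h2).dvd_iff_dvd_left).1 hgA
      have := coeff_zero_charpoly A
      rw [X_dvd_iff.1 h3, mul_zero] at this
      exact absurd this zero_ne_one
    · obtain ⟨t, ht⟩ : Fintype.card F ^ g.natDegree - 1 ∣ L :=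
        Finset.dvd_lcm (Finset.mem_Ico.2 ⟨hg.natDegree_pos, hA g hg hgA⟩)
      rw [ht, pow_mul]
      exact h2.trans (by
        simpa using sub_dvd_pow_sub_pow (X ^ (Fintype.card F ^ g.natDegree - 1) : F[X]) 1 t)
  obtain ⟨s, hs⟩ : ∃ s, N ≤ p ^ s := ⟨N, (Nat.lt_pow_self (Fact.out : p.Prime).one_lt).le⟩
  have h := hN.trans (pow_dvd_pow _ hs)
  rw [sub_pow_char_pow, one_pow, ← pow_mul, ← C_1] at h
  exact (hap.pow_right s).dvd_of_dvd_mul_right (ha.trans (orderOf_mk_dvd A h))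

end Matrix.ProjectiveSpecialLinearGroup

section FiniteField
variable {F : Type*} [Field F] [Fintype F]

theorem FiniteField.mem_range_algebraMap_of_pow_card_sub_one {K : Type*} [Field K] [Algebra F K]
    [Algebra.IsIntegral F K] {x : K} (hx : x ^ (Fintype.card F - 1) = 1) :
    ∃ c : F, algebraMap F K c = x := by
  have hint : IsIntegral F x := Algebra.IsIntegral.isIntegral x
  refine minpoly.natDegree_eq_one_iff.1 (Nat.dvd_one.1 ?_)
  refine (minpoly.irreducible hint).natDegree_dvd_of_dvd_X_pow_card_pow_sub_X (minpoly.dvd _ _ ?_)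
  have h : x ^ Fintype.card F = x := by
    rw [← Nat.sub_add_cancel (Fintype.card_pos (α := F)), pow_succ, hx, one_mul]
  simp [Nat.card_eq_fintype_card, h]

variable {f : F[X]}

theorem AdjoinRoot.root_pow_geomSum (hf : Irreducible f) (hm : f.Monic) :
    AdjoinRoot.root f ^ (∑ i ∈ Finset.range f.natDegree, Fintype.card F ^ i) =
      AdjoinRoot.of f ((-1) ^ f.natDegree * f.coeff 0) := by
  have : Fact (Irreducible f) := ⟨hf⟩
  let pb := AdjoinRoot.powerBasis hf.ne_zero
  have : Module.Finite F (AdjoinRoot f) := pb.finite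
  have : Finite (AdjoinRoot f) := Module.finite_of_finite F
  have h := Algebra.PowerBasis.norm_gen_eq_coeff_zero_minpoly pb
  rw [AdjoinRoot.minpoly_powerBasis_gen_of_monic hm] at h
  have h2 := FiniteField.algebraMap_norm_eq_pow (K := F) (x := pb.gen)
  rw [h, Module.natCard_eq_pow_finrank (K := F), pb.finrank, Nat.card_eq_fintype_card,
    ← Nat.geomSum_eq Fintype.one_lt_card] at h2
  exact h2.symm

theorem Irreducible.exists_dvd_X_pow_sub_C_of_norm_eq_one (hf : Irreducible f) (hm : f.Monic)
    (hnorm : (-1) ^ f.natDegree * f.coeff 0 = 1) {a d : ℕ}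
    (ha : a * d = ∑ i ∈ Finset.range f.natDegree, Fintype.card F ^ i)
    (hd : d ∣ Fintype.card F - 1) : ∃ c, f ∣ X ^ a - C c := by
  have : Fact (Irreducible f) := ⟨hf⟩
  have : Module.Finite F (AdjoinRoot f) := (AdjoinRoot.powerBasis hf.ne_zero).finite
  have h := AdjoinRoot.root_pow_geomSum hf hm
  rw [hnorm, map_one, ← ha, pow_mul] at h
  obtain ⟨t, ht⟩ := hd
  obtain ⟨c, hc⟩ := FiniteField.mem_range_algebraMap_of_pow_card_sub_one (F := F)
    (x := AdjoinRoot.root f ^ a) (by rw [ht, pow_mul, h, one_pow])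
  refine ⟨c, ?_⟩
  rw [← AdjoinRoot.mk_eq_zero, map_sub, map_pow, AdjoinRoot.mk_X, AdjoinRoot.mk_C, ← hc,
    AdjoinRoot.algebraMap_eq, sub_self]

theorem Irreducible.dvd_X_pow_sub_C_pow_of_norm_mul_eq_one (hf : Irreducible f) (hm : f.Monic)
    {c : F} (hnorm : (-1) ^ f.natDegree * f.coeff 0 * c = 1) {a d : ℕ}
    (ha : a * d = Fintype.card F ^ f.natDegree - 1)
    (hd : d ∣ 1 + ∑ i ∈ Finset.range f.natDegree, Fintype.card F ^ i) :
    f ∣ X ^ a - C (c ^ a) := by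
  have : Fact (Irreducible f) := ⟨hf⟩
  let pb := AdjoinRoot.powerBasis hf.ne_zero
  have : Module.Finite F (AdjoinRoot f) := pb.finite
  have : Finite (AdjoinRoot f) := Module.finite_of_finite F
  have := Fintype.ofFinite (AdjoinRoot f)
  have h := AdjoinRoot.root_pow_geomSum hf hm
  have hc := congrArg (AdjoinRoot.of f) hnorm
  rw [map_mul, ← h, map_one] at hc
  have hroot : AdjoinRoot.root f ≠ 0 := by
    intro h0
    rw [h0, zero_pow, zero_mul] at hc
    · exact zero_ne_one hc
    · exact (Finset.sum_pos (fun i _ => pow_pos Fintype.card_pos i)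
        (Finset.nonempty_range_iff.2 hf.natDegree_pos.ne')).ne'
  have hord := FiniteField.pow_card_sub_one_eq_one _ hroot
  rw [Module.card_eq_pow_finrank (K := F), pb.finrank] at hord
  change _ ^ (_ ^ f.natDegree - 1) = _ at hord
  obtain ⟨t, ht⟩ := hd
  have h1 : AdjoinRoot.root f ^ a *
      (AdjoinRoot.root f ^ (∑ i ∈ Finset.range f.natDegree, Fintype.card F ^ i)) ^ a = 1 := by
    rw [← mul_pow, ← pow_succ', add_comm, ht, ← pow_mul, mul_comm d, mul_assoc, mul_comm d, ha,
      mul_comm, pow_mul, hord, one_pow]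
  rw [← AdjoinRoot.mk_eq_zero, map_sub, map_pow, AdjoinRoot.mk_X, AdjoinRoot.mk_C, map_pow,
    sub_eq_zero]
  calc _ = AdjoinRoot.root f ^ a * (AdjoinRoot.root f ^
        (∑ i ∈ Finset.range f.natDegree, Fintype.card F ^ i) * AdjoinRoot.of f c) ^ a := by
        rw [hc, one_pow, mul_one]
    _ = _ := by rw [mul_pow, ← mul_assoc, h1, one_mul]

end FiniteField

namespace Matrix.ProjectiveSpecialLinearGroup

theorem exists_orderOf_eq_of_norm_eq_one {ι F R : Type*} [DecidableEq ι] [Fintype ι] [CommRing F]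
    [Ring R] [Algebra F R] (b : Module.Basis ι F R) {x : R} (hx : Algebra.norm F x = 1) {a : ℕ}
    (ha : ∀ k, (∃ c, x ^ k = algebraMap F R c) ↔ a ∣ k) :
    ∃ g : ProjectiveSpecialLinearGroup ι F, orderOf g = a := by
  let A : SpecialLinearGroup ι F :=
    ⟨Algebra.leftMulMatrix b x, by rw [← Algebra.norm_eq_matrix_det, hx]⟩
  refine ⟨A, Nat.dvd_right_iff_eq.1 fun k => ?_⟩
  rw [orderOf_dvd_iff_pow_eq_one, mk_pow_eq_one_iff, ← ha]
  refine exists_congr fun c => ?_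
  change Algebra.leftMulMatrix b x ^ k = _ ↔ _
  rw [← map_pow, ← AlgHom.commutes (Algebra.leftMulMatrix b),
    (Algebra.leftMulMatrix_injective b).eq_iff]

end Matrix.ProjectiveSpecialLinearGroup

theorem Algebra.norm_prodMk {F K L : Type*} [Field F] [Ring K] [Ring L] [Algebra F K]
    [Algebra F L] [Module.Finite F K] [Module.Finite F L] (x : K) (y : L) :
    Algebra.norm F (x, y) = Algebra.norm F x * Algebra.norm F y := by
  rw [Algebra.norm_apply, Algebra.norm_apply, Algebra.norm_apply, ← LinearMap.det_prodMap]
  congr 1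

section Existence
open Matrix
variable {F : Type*} [Field F] [Fintype F]

theorem FiniteField.exists_orderOf_eq_card_sub_one (K : Type*) [Field K] [Finite K] :
    ∃ x : K, orderOf x = Nat.card K - 1 := by
  obtain ⟨u, hu⟩ := IsCyclic.exists_ofOrder_eq_natCard (α := Kˣ)
  exact ⟨u, by rw [orderOf_units, hu, Nat.card_units]⟩

theorem exists_finiteField_extension (F : Type*) [Field F] [Fintype F] {n : ℕ} (hn : 0 < n) :
    ∃ (K : Type) (_ : Field K) (_ : Finite K) (_ : Algebra F K), Module.finrank F K = n := by
  obtain ⟨p, hp⟩ := CharP.exists F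
  have : Fact p.Prime := ⟨CharP.char_is_prime F p⟩
  have : NeZero n := ⟨hn.ne'⟩
  exact ⟨FiniteField.Extension F p n, inferInstance, inferInstance, inferInstance,
    FiniteField.finrank_extension F p n⟩

theorem exists_orderOf_eq_geomSum_div {n a d : ℕ} (hn : 0 < n)
    (hd : d = n.gcd (Fintype.card F - 1))
    (ha : a * d = ∑ i ∈ Finset.range n, Fintype.card F ^ i) :
    ∃ g : ProjectiveSpecialLinearGroup (Fin n) F, orderOf g = a := by
  have hq : 1 < Fintype.card F := Fintype.one_lt_card
  obtain ⟨K, _, _, _, hK⟩ := exists_finiteField_extension F hn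
  obtain ⟨x, hx⟩ := FiniteField.exists_orderOf_eq_card_sub_one K
  rw [Module.natCard_eq_pow_finrank (K := F), hK, Nat.card_eq_fintype_card,
    ← geomSum_mul_sub_one _ _ hq.le, ← ha] at hx
  have hd0 : 0 < d := hd ▸ Nat.gcd_pos_of_pos_left _ hn
  have hS : 0 < a * d := ha ▸ Finset.sum_pos (fun i _ => pow_pos Fintype.card_pos i)
    (Finset.nonempty_range_iff.2 hn.ne')
  have hx0 : x ≠ 0 := by
    rintro rfl
    rw [orderOf_zero] at hx
    exact (Nat.mul_pos hS (Nat.sub_pos_of_lt hq)).ne hx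
  have hnx : Algebra.norm F x ≠ 0 := Algebra.norm_ne_zero_iff.2 hx0
  refine Matrix.ProjectiveSpecialLinearGroup.exists_orderOf_eq_of_norm_eq_one
    (x := x ^ (Fintype.card F - 1)) (Module.finBasisOfFinrankEq F K hK)
    (by rw [map_pow, FiniteField.pow_card_sub_one_eq_one _ hnx]) fun k => ?_
  obtain ⟨t, ht⟩ : d ∣ Fintype.card F - 1 := hd ▸ Nat.gcd_dvd_right _ _
  have hcop : a.Coprime t := by
    have h := gcd_geomSum (Fintype.card F) n hq.le
    rw [← ha, ht, ← ht, ← hd, ht, mul_comm, Nat.gcd_mul_left] at h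
    exact Nat.eq_of_mul_eq_mul_left hd0 (by rw [h, mul_one])
  have h1 : (∃ c, (x ^ (Fintype.card F - 1)) ^ k = algebraMap F K c) ↔
      x ^ (k * (Fintype.card F - 1) * (Fintype.card F - 1)) = 1 := by
    rw [← pow_mul, mul_comm (Fintype.card F - 1), pow_mul _ (k * _)]
    constructor
    · rintro ⟨c, hc⟩
      have hc0 : c ≠ 0 := by
        rintro rfl
        exact pow_ne_zero _ hx0 (hc.trans (map_zero _))
      rw [hc, ← map_pow, FiniteField.pow_card_sub_one_eq_one c hc0, map_one]
    · intro h
      obtain ⟨c, hc⟩ := FiniteField.mem_range_algebraMap_of_pow_card_sub_one (F := F) h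
      exact ⟨c, hc.symm⟩
  rw [h1, ← orderOf_dvd_iff_pow_eq_one, hx, Nat.mul_dvd_mul_iff_right (Nat.sub_pos_of_lt hq), ht,
    mul_left_comm, mul_comm a, Nat.mul_dvd_mul_iff_left hd0, hcop.dvd_mul_right]

theorem exists_orderOf_eq_pow_sub_one_div {n a d : ℕ} (hn : 0 < n)
    (hd : d = (n + 1).gcd (Fintype.card F - 1))
    (ha : a * d = Fintype.card F ^ n - 1) :
    ∃ g : ProjectiveSpecialLinearGroup (Fin (n + 1)) F, orderOf g = a := by
  have hq : 1 < Fintype.card F := Fintype.one_lt_card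
  have hd0 : 0 < d := hd ▸ Nat.gcd_pos_of_pos_left _ n.succ_pos
  obtain ⟨K, _, _, _, hK⟩ := exists_finiteField_extension F hn
  obtain ⟨x, hx⟩ := FiniteField.exists_orderOf_eq_card_sub_one K
  have hnorm := FiniteField.algebraMap_norm_eq_pow (K := F) (x := x)
  rw [Module.natCard_eq_pow_finrank (K := F), hK, Nat.card_eq_fintype_card] at hx hnorm
  rw [← Nat.geomSum_eq hq] at hnorm
  have hx0 : x ≠ 0 := by
    rintro rfl
    rw [orderOf_zero] at hx
    exact (Nat.sub_pos_of_lt (Nat.one_lt_pow hn.ne' hq)).ne hx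
  have hnx : Algebra.norm F x ≠ 0 := Algebra.norm_ne_zero_iff.2 hx0
  refine Matrix.ProjectiveSpecialLinearGroup.exists_orderOf_eq_of_norm_eq_one
    (x := (x, (Algebra.norm F x)⁻¹))
    (Module.finBasisOfFinrankEq F (K × F) (by rw [Module.finrank_prod, hK, Module.finrank_self]))
    (by rw [Algebra.norm_prodMk, Algebra.norm_self]; exact mul_inv_cancel₀ hnx) fun k => ?_
  have hgcd := gcd_one_add_geomSum (Fintype.card F) n hq.le
  rw [← hd] at hgcd
  have h1 : (∃ c, (x, (Algebra.norm F x)⁻¹) ^ k = algebraMap F (K × F) c) ↔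
      x ^ ((1 + ∑ i ∈ Finset.range n, Fintype.card F ^ i) * k) = 1 := by
    rw [pow_mul, pow_add, pow_one, ← hnorm, mul_pow]
    have hN : algebraMap F K (Algebra.norm F x) ^ k ≠ 0 := pow_ne_zero _ (by simpa using hnx)
    constructor
    · rintro ⟨c, hc⟩
      obtain ⟨hc1, hc2⟩ := Prod.ext_iff.1 hc
      change x ^ k = algebraMap F K c at hc1
      change (Algebra.norm F x)⁻¹ ^ k = c at hc2
      rw [hc1, ← hc2, map_pow, map_inv₀, inv_pow, inv_mul_cancel₀ hN]
    · intro h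
      refine ⟨(Algebra.norm F x)⁻¹ ^ k, Prod.ext ?_ rfl⟩
      change x ^ k = algebraMap F K _
      rw [map_pow, map_inv₀, inv_pow, eq_inv_of_mul_eq_one_left h]
  rw [h1, ← orderOf_dvd_iff_pow_eq_one, hx]
  have hpos : 0 < Fintype.card F ^ n - 1 := Nat.sub_pos_of_lt (Nat.one_lt_pow hn.ne' hq)
  constructor
  · intro h
    have h2 := Nat.dvd_gcd h (dvd_mul_right (Fintype.card F ^ n - 1) k)
    rw [Nat.gcd_mul_right, hgcd, ← ha, mul_comm a] at h2
    exact Nat.dvd_of_mul_dvd_mul_left hd0 h2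
  · intro h
    rw [← ha, mul_comm]
    exact mul_dvd_mul (hgcd ▸ Nat.gcd_dvd_left _ _) h

end Existence

namespace Matrix.ProjectiveSpecialLinearGroup
variable {F : Type*} [Field F] [Fintype F] {n : ℕ} (A : SpecialLinearGroup (Fin n) F)

theorem orderOf_mk_dvd_of_irreducible_charpoly
    (hA : Irreducible (A : Matrix (Fin n) (Fin n) F).charpoly) {a d : ℕ}
    (ha : a * d = ∑ i ∈ Finset.range n, Fintype.card F ^ i) (hd : d ∣ Fintype.card F - 1) :
    orderOf (A : ProjectiveSpecialLinearGroup (Fin n) F) ∣ a := by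
  have hdeg : (A : Matrix (Fin n) (Fin n) F).charpoly.natDegree = n := by
    simp [charpoly_natDegree_eq_dim]
  obtain ⟨c, hc⟩ := hA.exists_dvd_X_pow_sub_C_of_norm_eq_one (charpoly_monic _) (a := a) (d := d)
    (by simpa [hdeg] using coeff_zero_charpoly A) (by rw [hdeg, ha]) hd
  exact orderOf_mk_dvd A hc

/-- If the characteristic polynomial has an irreducible factor of codegree one, then the order
modulo scalars divides `(q ^ (n - 1) - 1) / d`, unless it is a power of the characteristic. -/
theorem orderOf_mk_dvd_or_dvd_pow_of_natDegree_add_one_eq {p : ℕ} [Fact p.Prime] [CharP F p]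
    {g : F[X]} (hg : Irreducible g) (hm : g.Monic)
    (hgA : g ∣ (A : Matrix (Fin n) (Fin n) F).charpoly) (hgn : g.natDegree + 1 = n) {a d : ℕ}
    (ha : a * d = Fintype.card F ^ (n - 1) - 1)
    (hd : d ∣ n.gcd (Fintype.card F - 1)) :
    orderOf (A : ProjectiveSpecialLinearGroup (Fin n) F) ∣ a ∨
      ∃ s, orderOf (A : ProjectiveSpecialLinearGroup (Fin n) F) ∣ p ^ s := by
  obtain ⟨h, hh⟩ := hgA
  have hhm : h.Monic := hm.of_mul_monic_left (hh ▸ charpoly_monic _)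
  have hdeg := congrArg natDegree hh
  rw [hm.natDegree_mul hhm, charpoly_natDegree_eq_dim, Fintype.card_fin, ← hgn,
    Nat.add_left_cancel_iff] at hdeg
  obtain ⟨c, rfl⟩ : ∃ c, h = X - C c :=
    ⟨-h.coeff 0, by rw [C_neg, sub_neg_eq_add]; exact hhm.eq_X_add_C hdeg.symm⟩
  by_cases hgc : g = X - C c
  · refine .inr ⟨1, orderOf_mk_dvd A (c := c ^ p ^ 1) ?_⟩
    rw [hh, hgc, C_pow, ← sub_pow_char_pow, ← pow_two, pow_one]
    exact pow_dvd_pow _ (Fact.out : p.Prime).two_le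
  · refine .inl (orderOf_mk_dvd A (c := c ^ a) ?_)
    have hcop : IsCoprime g (X - C c) := by
      rw [hg.coprime_iff_not_dvd]
      exact fun h => hgc (eq_of_monic_of_associated hm (monic_X_sub_C c)
        (hg.associated_of_dvd (irreducible_X_sub_C c) h))
    rw [hh]
    refine hcop.mul_dvd (hg.dvd_X_pow_sub_C_pow_of_norm_mul_eq_one hm (d := d) ?_ ?_ ?_) ?_
    · have h0 := coeff_zero_charpoly A
      rw [hh, mul_coeff_zero, Fintype.card_fin, ← hgn, pow_succ] at h0
      refine Eq.trans ?_ h0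
      rw [coeff_sub, coeff_X_zero, coeff_C_zero]
      ring
    · rw [ha, ← hgn, Nat.add_sub_cancel]
    · rw [← hgn, ← gcd_one_add_geomSum _ _ Fintype.card_pos] at hd
      exact hd.trans (Nat.gcd_dvd_left _ _)
    · rw [dvd_iff_isRoot]
      simp

end Matrix.ProjectiveSpecialLinearGroup

/-- In a simple group `L = PSL_n(q)`, the numbers `(q^n - 1)/(d(q-1))` and
`(q^{n-1} - 1)/d`, where `d = gcd(n, q-1)`, are coprime element orders that are maximal
under divisibility in the spectrum of `L`. -/
theorem PSL_maximal_orders (p m q n : ℕ) (hp : p.Prime) (hm : 0 < m) (hq : q = p ^ m)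
    (hn : 2 ≤ n) (h22 : ¬ (n = 2 ∧ q = 2)) (h23 : ¬ (n = 2 ∧ q = 3))
    (F : Type*) [Field F] [Fintype F] (hF : Fintype.card F = q)
    (d a₁ a₂ : ℕ) (hd : d = Nat.gcd n (q - 1))
    (ha₁ : a₁ = (q ^ n - 1) / (d * (q - 1))) (ha₂ : a₂ = (q ^ (n - 1) - 1) / d) :
    Nat.Coprime a₁ a₂ ∧
      (∃ g : Matrix.ProjectiveSpecialLinearGroup (Fin n) F, orderOf g = a₁) ∧
      (∃ g : Matrix.ProjectiveSpecialLinearGroup (Fin n) F, orderOf g = a₂) ∧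
      (∀ g : Matrix.ProjectiveSpecialLinearGroup (Fin n) F,
        (a₁ ∣ orderOf g → orderOf g = a₁) ∧ (a₂ ∣ orderOf g → orderOf g = a₂)) := by
  classical
  have hq2 : 2 ≤ q := hF ▸ Fintype.one_lt_card
  have hd0 : 0 < d := hd ▸ Nat.gcd_pos_of_pos_left _ (by omega)
  have hdq : d ∣ q - 1 := hd ▸ Nat.gcd_dvd_right _ _
  have hdS : d ∣ ∑ i ∈ Finset.range n, q ^ i := by
    rw [hd, ← gcd_geomSum q n (by omega)]
    exact Nat.gcd_dvd_left _ _
  have hS : a₁ * d = ∑ i ∈ Finset.range n, q ^ i := by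
    rw [ha₁, ← geomSum_mul_sub_one q n (by omega),
      Nat.mul_div_mul_right _ _ (Nat.sub_pos_of_lt hq2), Nat.div_mul_cancel hdS]
  have hT : a₂ * d = q ^ (n - 1) - 1 := by
    rw [ha₂]
    refine Nat.div_mul_cancel (hdq.trans ?_)
    rw [← geomSum_mul_sub_one q (n - 1) (by omega)]
    exact dvd_mul_left _ _
  have hdvd₁ : a₁ ∣ q ^ n - 1 := by
    rw [← geomSum_mul_sub_one q n (by omega), ← hS, mul_assoc]
    exact dvd_mul_right _ _
  have hdvd₂ : a₂ ∣ q ^ (n - 1) - 1 := hT ▸ dvd_mul_right _ _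
  have ha₁0 : a₁ ≠ 0 := by
    rintro rfl
    have : 0 < q ^ n - 1 := Nat.sub_pos_of_lt (Nat.one_lt_pow (by omega) hq2)
    rw [zero_dvd_iff] at hdvd₁
    omega
  have ha₂0 : a₂ ≠ 0 := by
    rintro rfl
    have : 0 < q ^ (n - 1) - 1 := Nat.sub_pos_of_lt (Nat.one_lt_pow (by omega) hq2)
    omega
  have ha₂1 : a₂ ≠ 1 := by
    rintro rfl
    have hdle : d ≤ q - 1 := Nat.le_of_dvd (by omega) hdq
    rcases hn.eq_or_lt with rfl | hn3
    · have hd2 : d ∣ 2 := hd ▸ Nat.gcd_dvd_left _ _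
      have := Nat.le_of_dvd two_pos hd2
      simp only [Nat.add_one_sub_one, pow_one] at hT
      omega
    · have h1 : q ^ 2 ≤ q ^ (n - 1) := Nat.pow_le_pow_right (by omega) (by omega)
      have h2 : 2 * q ≤ q ^ 2 := by nlinarith
      omega
  have hcop : a₁.Coprime a₂ := by
    have h1 : a₁.Coprime ((q - 1) / d) := by
      have := Nat.coprime_div_gcd_div_gcd (m := ∑ i ∈ Finset.range n, q ^ i) (n := q - 1)
        (by rw [gcd_geomSum _ _ (by omega), ← hd]; exact hd0)
      rwa [gcd_geomSum _ _ (by omega), ← hd, ← hS, Nat.mul_div_cancel _ hd0] at this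
    have h2 : a₁.Coprime (∑ i ∈ Finset.range (n - 1), q ^ i) := by
      refine Nat.Coprime.of_dvd_left (hS ▸ dvd_mul_right a₁ d) ?_
      obtain ⟨k, rfl⟩ : ∃ k, n = k + 1 := ⟨n - 1, by omega⟩
      rw [geom_sum_succ]
      simp
    have h3 : a₂ = (∑ i ∈ Finset.range (n - 1), q ^ i) * ((q - 1) / d) := by
      rw [← Nat.mul_div_assoc _ hdq, geomSum_mul_sub_one _ _ (by omega), ha₂]
    exact h3 ▸ h2.mul_right h1
  have hpow : ∀ {k a : ℕ}, 0 < k → a ∣ q ^ k - 1 → a.Coprime p := by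
    intro k a hk ha
    have hpq : p ∣ q ^ k := dvd_pow (hq ▸ dvd_pow_self p hm.ne') hk.ne'
    refine Nat.Coprime.of_dvd ha hpq ?_
    rw [Nat.coprime_self_sub_left (Nat.one_le_pow _ _ (by omega))]
    exact Nat.coprime_one_left _
  have hp' : Fact p.Prime := ⟨hp⟩
  have hchar : CharP F p := charP_of_card_eq_prime_pow (hF.trans hq)
  have hpos : 0 < n - 1 := by omega
  have hirr : ∀ A : Matrix.SpecialLinearGroup (Fin n) F,
      Irreducible (A : Matrix (Fin n) (Fin n) F).charpoly →
      orderOf (A : Matrix.ProjectiveSpecialLinearGroup (Fin n) F) ∣ a₁ := fun A hA =>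
    Matrix.ProjectiveSpecialLinearGroup.orderOf_mk_dvd_of_irreducible_charpoly A hA
      (by rw [hS, hF]) (hF ▸ hdq)
  have hlt : ∀ A : Matrix.SpecialLinearGroup (Fin n) F,
      ¬ Irreducible (A : Matrix (Fin n) (Fin n) F).charpoly →
      ∀ g : F[X], Irreducible g → g ∣ (A : Matrix (Fin n) (Fin n) F).charpoly →
        g.natDegree < n := by
    intro A hA g hg hgA
    have hdeg : (A : Matrix (Fin n) (Fin n) F).charpoly.natDegree = n := by
      simp [Matrix.charpoly_natDegree_eq_dim]
    have hne := (Matrix.charpoly_monic (A : Matrix (Fin n) (Fin n) F)).ne_zero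
    refine lt_of_le_of_ne ((natDegree_le_of_dvd hgA hne).trans_eq hdeg) fun h => hA ?_
    exact (associated_of_dvd_of_natDegree_le hgA hne (by rw [hdeg, h])).irreducible hg
  refine ⟨hcop, exists_orderOf_eq_geomSum_div (d := d) (by omega) (by rw [hd, hF])
    (by rw [hS, hF]), ?_, fun g => ?_⟩
  · obtain ⟨k, rfl⟩ : ∃ k, n = k + 1 := ⟨n - 1, by omega⟩
    exact exists_orderOf_eq_pow_sub_one_div (d := d) hpos (by rw [hd, hF]) (by rw [hT, hF]; rfl)
  obtain ⟨A, rfl⟩ := QuotientGroup.mk_surjective g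
  refine ⟨fun h => ?_, fun h => ?_⟩
  · by_cases hA : Irreducible (A : Matrix (Fin n) (Fin n) F).charpoly
    · exact Nat.dvd_antisymm (hirr A hA) h
    · exfalso
      have hL := Matrix.ProjectiveSpecialLinearGroup.dvd_lcm_of_dvd_orderOf_mk A (hlt A hA)
        (hpow (by omega) hdvd₁) h
      rw [hF] at hL
      have h1 := mul_eval_cyclotomic_dvd_pow_sub_one hq2 (by omega) le_rfl hdvd₁ hL
      refine not_eval_cyclotomic_dvd_gcd_mul hn hq2 h22 h23 ?_
      have h2 : ((q : ℤ) ^ n - 1) = a₁ * ((n.gcd (q - 1) : ℤ) * (q - 1)) := by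
        have := geomSum_mul_sub_one q n (by omega)
        rw [← hS, hd] at this
        zify [Nat.one_le_pow n q (by omega), (by omega : 1 ≤ q)] at this
        rw [← this, mul_assoc]
      rwa [h2, mul_dvd_mul_iff_left (by exact_mod_cast ha₁0)] at h1
  · by_cases hA : Irreducible (A : Matrix (Fin n) (Fin n) F).charpoly
    · exact absurd (Nat.eq_one_of_dvd_coprimes hcop (h.trans (hirr A hA)) dvd_rfl) ha₂1
    by_cases hB : ∃ g : F[X], Irreducible g ∧ g ∣ (A : Matrix (Fin n) (Fin n) F).charpoly ∧
        g.natDegree + 1 = n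
    · obtain ⟨g, hg, hgA, hgn⟩ := hB
      have hass := normalize_associated g
      rcases Matrix.ProjectiveSpecialLinearGroup.orderOf_mk_dvd_or_dvd_pow_of_natDegree_add_one_eq
        (p := p) A (hass.symm.irreducible hg) (monic_normalize hg.ne_zero)
        (hass.dvd_iff_dvd_left.2 hgA) (by rwa [natDegree_eq_of_degree_eq degree_normalize]) (a := a₂) (d := d)
        (by rw [hT, hF]) (by rw [hd, hF]) with h1 | ⟨s, hs⟩
      · exact Nat.dvd_antisymm h1 h
      · exact absurd (((hpow hpos hdvd₂).pow_right s).eq_one_of_dvd (h.trans hs)) ha₂1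
    · exfalso
      have hL := Matrix.ProjectiveSpecialLinearGroup.dvd_lcm_of_dvd_orderOf_mk A (r := n - 1)
        (fun g hg hgA => by
          have := hlt A hA g hg hgA
          have : g.natDegree + 1 ≠ n := fun h' => hB ⟨g, hg, hgA, h'⟩
          omega) (hpow hpos hdvd₂) h
      rcases hn.eq_or_lt with rfl | hn3
      · simp at hL
        exact ha₂1 hL
      · rw [hF] at hL
        have h1 := mul_eval_cyclotomic_dvd_pow_sub_one hq2 hpos le_rfl hdvd₂ hL
        refine not_eval_cyclotomic_dvd_gcd (n := n - 1) (by omega) hq2 hdq ?_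
        have h2 : ((q : ℤ) ^ (n - 1) - 1) = a₂ * d := by
          zify [Nat.one_le_pow (n - 1) q (by omega)] at hT
          exact hT.symm
        rwa [h2, mul_dvd_mul_iff_left (by exact_mod_cast ha₂0)] at h1
end

section
/- For every real number x ≥ 57, the half-open interval (2x/3, x − 16] contains at least one prime number. -/
open ArithmeticFunction in
/-- Chebyshev's identity `log N! = ∑_{n ≤ N} Λ(n) ⌊N / n⌋`. -/
theorem log_factorial_eq_sum_vonMangoldt (N : ℕ) :
    Real.log (N.factorial : ℝ) = ∑ n ∈ Finset.Ioc 0 N, vonMangoldt n * ((N / n : ℕ) : ℝ) := by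
  rw [← sum_Ioc_mul_zeta_eq_sum, vonMangoldt_mul_zeta]
  induction N with
  | zero => simp
  | succ N ih =>
    rw [Finset.sum_Ioc_succ_top (Nat.zero_le N), ← ih, Nat.factorial_succ, Nat.cast_mul,
      Real.log_mul (by positivity) (by positivity), log_apply]
    ring

open ArithmeticFunction in
theorem log_factorial_div_eq_sum_vonMangoldt (N k : ℕ) :
    Real.log ((N / k).factorial : ℝ) =
      ∑ n ∈ Finset.Ioc 0 N, vonMangoldt n * ((N / n / k : ℕ) : ℝ) := by
  rw [log_factorial_eq_sum_vonMangoldt]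
  have hsub : Finset.Ioc 0 (N / k) ⊆ Finset.Ioc 0 N :=
    Finset.Ioc_subset_Ioc_right (Nat.div_le_self N k)
  rw [← Finset.sum_subset hsub]
  · refine Finset.sum_congr rfl fun n _ => ?_
    rw [Nat.div_right_comm]
  · intro n _ hn
    have hlt : N / k < n := by
      simp only [Finset.mem_Ioc] at *
      omega
    rw [Nat.div_right_comm, Nat.div_eq_of_lt hlt]
    simp

/-- The logarithm of Chebyshev's quotient `N! ⌊N/30⌋! / (⌊N/2⌋! ⌊N/3⌋! ⌊N/5⌋!)`. -/
noncomputable def chebyshevQuotientLog (N : ℕ) : ℝ :=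
  Real.log (N.factorial : ℝ) - Real.log ((N / 2).factorial : ℝ) -
    Real.log ((N / 3).factorial : ℝ) - Real.log ((N / 5).factorial : ℝ) +
    Real.log ((N / 30).factorial : ℝ)

open ArithmeticFunction in
theorem chebyshevQuotientLog_eq_sum (N : ℕ) :
    chebyshevQuotientLog N = ∑ n ∈ Finset.Ioc 0 N, vonMangoldt n *
      (((N / n : ℕ) : ℝ) - ((N / n / 2 : ℕ) : ℝ) - ((N / n / 3 : ℕ) : ℝ) -
        ((N / n / 5 : ℕ) : ℝ) + ((N / n / 30 : ℕ) : ℝ)) := by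
  simp only [chebyshevQuotientLog, log_factorial_div_eq_sum_vonMangoldt,
    log_factorial_eq_sum_vonMangoldt N, mul_add, mul_sub, Finset.sum_add_distrib,
    Finset.sum_sub_distrib]

theorem chebyshevQuotientLog_le_psi (N : ℕ) :
    chebyshevQuotientLog N ≤ Chebyshev.psi N := by
  rw [chebyshevQuotientLog_eq_sum, Chebyshev.psi, Nat.floor_natCast]
  refine Finset.sum_le_sum fun n _ => mul_le_of_le_one_right
    ArithmeticFunction.vonMangoldt_nonneg ?_
  have h : N / n + N / n / 30 ≤ 1 + N / n / 2 + N / n / 3 + N / n / 5 := by omega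
  have h' : ((N / n : ℕ) : ℝ) + ((N / n / 30 : ℕ) : ℝ) ≤
    1 + ((N / n / 2 : ℕ) : ℝ) + ((N / n / 3 : ℕ) : ℝ) + ((N / n / 5 : ℕ) : ℝ) := by
    exact_mod_cast h
  linarith

theorem psi_le_chebyshevQuotientLog_add (N : ℕ) :
    Chebyshev.psi N ≤ chebyshevQuotientLog N + Chebyshev.psi (N / 6 : ℕ) := by
  have hsub : Finset.Ioc 0 (N / 6) ⊆ Finset.Ioc 0 N :=
    Finset.Ioc_subset_Ioc_right (Nat.div_le_self N 6)
  rw [chebyshevQuotientLog_eq_sum, Chebyshev.psi, Chebyshev.psi, Nat.floor_natCast,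
    Nat.floor_natCast, ← Finset.sum_sdiff hsub, ← Finset.sum_sdiff hsub, add_le_add_iff_right]
  have hnonneg : ∀ n : ℕ, 0 ≤ ((N / n : ℕ) : ℝ) - ((N / n / 2 : ℕ) : ℝ) -
      ((N / n / 3 : ℕ) : ℝ) - ((N / n / 5 : ℕ) : ℝ) + ((N / n / 30 : ℕ) : ℝ) := by
    intro n
    have h : N / n / 2 + N / n / 3 + N / n / 5 ≤ N / n + N / n / 30 := by omega
    have h' : ((N / n / 2 : ℕ) : ℝ) + ((N / n / 3 : ℕ) : ℝ) + ((N / n / 5 : ℕ) : ℝ) ≤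
      ((N / n : ℕ) : ℝ) + ((N / n / 30 : ℕ) : ℝ) := by exact_mod_cast h
    linarith
  refine le_add_of_le_of_nonneg (Finset.sum_le_sum fun n hn => ?_)
    (Finset.sum_nonneg fun n _ => mul_nonneg ArithmeticFunction.vonMangoldt_nonneg (hnonneg n))
  refine le_mul_of_one_le_right ArithmeticFunction.vonMangoldt_nonneg ?_
  simp only [Finset.mem_sdiff, Finset.mem_Ioc] at hn
  have hpos : 1 ≤ N / n := (Nat.one_le_div_iff hn.1.1).2 hn.1.2
  have hlt : N / n < 6 := by
    rw [Nat.div_lt_iff_lt_mul hn.1.1]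
    omega
  generalize N / n = m at *
  interval_cases m <;> norm_num

theorem log_factorial_le_stirling {n : ℕ} (hn : 1 ≤ n) :
    Real.log (n.factorial : ℝ) ≤ n * Real.log n - n + Real.log n + 1 := by
  induction n, hn using Nat.le_induction with
  | base => simp
  | succ n hn ih =>
    have hn0 : (0 : ℝ) < n := by exact_mod_cast hn
    rw [Nat.factorial_succ, Nat.cast_mul, Real.log_mul (by positivity) (by positivity)]
    push_cast
    have h := Real.one_sub_inv_le_log_of_pos (x := ((n : ℝ) + 1) / n) (by positivity)
    rw [Real.log_div (by positivity) (by positivity), inv_div] at h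
    have h' := mul_le_mul_of_nonneg_left h (by positivity : (0 : ℝ) ≤ n + 1)
    have e : ((n : ℝ) + 1) * (1 - n / (n + 1)) = 1 := by field_simp; ring
    rw [e] at h'
    linarith

/-- Tangent line inequality for the convex function `x log x - x`. -/
theorem mul_log_sub_tangent_le {a b : ℝ} (ha : 0 < a) (hb : 0 < b) :
    a * Real.log a - a + (b - a) * Real.log a ≤ b * Real.log b - b := by
  have h := Real.one_sub_inv_le_log_of_pos (x := b / a) (by positivity)
  rw [Real.log_div (by positivity) (by positivity), inv_div] at h
  have h' := mul_le_mul_of_nonneg_left h hb.le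
  have e : b * (1 - a / b) = b - a := by field_simp
  rw [e] at h'
  linarith

theorem log_factorial_floor_le {y : ℝ} (hy : 1 ≤ y) :
    Real.log (⌊y⌋₊.factorial : ℝ) ≤ y * Real.log y - y + Real.log y + 1 := by
  have hn : 1 ≤ ⌊y⌋₊ := (Nat.one_le_floor_iff y).2 hy
  have hn' : (1 : ℝ) ≤ ⌊y⌋₊ := by exact_mod_cast hn
  have hle : (⌊y⌋₊ : ℝ) ≤ y := Nat.floor_le (by linarith)
  have h := log_factorial_le_stirling hn
  have ht := mul_log_sub_tangent_le (a := ⌊y⌋₊) (b := y) (by linarith) (by linarith)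
  have hlog := Real.log_le_log (by linarith) hle
  have := mul_nonneg (sub_nonneg.2 hle) (Real.log_nonneg hn')
  linarith

theorem le_log_factorial_floor {y : ℝ} (hy : 1 ≤ y) :
    y * Real.log y - y - Real.log y ≤ Real.log (⌊y⌋₊.factorial : ℝ) := by
  have hn : 1 ≤ ⌊y⌋₊ := (Nat.one_le_floor_iff y).2 hy
  have hn' : (1 : ℝ) ≤ ⌊y⌋₊ := by exact_mod_cast hn
  have h := Stirling.le_log_factorial_stirling (n := ⌊y⌋₊) (by omega)
  have ht := mul_log_sub_tangent_le (a := y) (b := ⌊y⌋₊) (by linarith) (by linarith)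
  have hlt := Nat.lt_floor_add_one y
  have h1 := mul_nonneg (by linarith : 0 ≤ (⌊y⌋₊ : ℝ) + 1 - y) (Real.log_nonneg hy)
  have h2 := Real.log_nonneg hn'
  have h3 : 0 ≤ Real.log (2 * Real.pi) := Real.log_nonneg (by linarith [Real.pi_gt_three])
  linarith

/-- Chebyshev's constant `log (2^(1/2) 3^(1/3) 5^(1/5) / 30^(1/30))`. -/
noncomputable def chebyshevConstant : ℝ :=
  Real.log 2 / 2 + Real.log 3 / 3 + Real.log 5 / 5 - Real.log 30 / 30

theorem log_factorial_div_bounds {N k : ℕ} (hk : 1 ≤ k) (hkN : k ≤ N) :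
    (N : ℝ) / k * (Real.log N - Real.log k) - N / k - Real.log N
        ≤ Real.log ((N / k).factorial : ℝ) ∧
      Real.log ((N / k).factorial : ℝ) ≤
        (N : ℝ) / k * (Real.log N - Real.log k) - N / k + Real.log N + 1 := by
  have hk0 : (1 : ℝ) ≤ k := by exact_mod_cast hk
  have hN0 : (k : ℝ) ≤ N := by exact_mod_cast hkN
  have hy : (1 : ℝ) ≤ (N : ℝ) / k := by rwa [one_le_div (by linarith)]
  have hl := le_log_factorial_floor hy
  have hu := log_factorial_floor_le hy
  rw [Nat.floor_div_eq_div, Real.log_div (by linarith) (by linarith)] at hl hu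
  have := Real.log_nonneg hk0
  constructor <;> linarith

theorem abs_chebyshevQuotientLog_sub_le {N : ℕ} (hN : 30 ≤ N) :
    |chebyshevQuotientLog N - chebyshevConstant * N| ≤ 5 * Real.log N + 5 := by
  obtain ⟨l1, u1⟩ := log_factorial_div_bounds (N := N) (k := 1) (by norm_num) (by omega)
  obtain ⟨l2, u2⟩ := log_factorial_div_bounds (N := N) (k := 2) (by norm_num) (by omega)
  obtain ⟨l3, u3⟩ := log_factorial_div_bounds (N := N) (k := 3) (by norm_num) (by omega)
  obtain ⟨l5, u5⟩ := log_factorial_div_bounds (N := N) (k := 5) (by norm_num) (by omega)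
  obtain ⟨l30, u30⟩ := log_factorial_div_bounds (N := N) (k := 30) (by norm_num) hN
  simp only [Nat.div_one, Nat.cast_one, Nat.cast_ofNat, Real.log_one] at *
  rw [chebyshevQuotientLog, chebyshevConstant, abs_le]
  constructor <;> linarith

theorem chebyshevConstant_gt : 0.76 < chebyshevConstant := by
  have h2 := Real.log_two_gt_d9
  have h3 : Real.log 2 ≤ Real.log 3 := Real.log_le_log (by norm_num) (by norm_num)
  have h5 : Real.log 4 ≤ Real.log 5 := Real.log_le_log (by norm_num) (by norm_num)
  have h4 : Real.log 4 = 2 * Real.log 2 := by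
    rw [show (4 : ℝ) = 2 ^ 2 by norm_num, Real.log_pow]; norm_num
  have h30 : Real.log 30 = Real.log 2 + Real.log 3 + Real.log 5 := by
    rw [← Real.log_mul (by norm_num) (by norm_num), ← Real.log_mul (by norm_num) (by norm_num)]
    norm_num
  rw [chebyshevConstant, h30]
  linarith

theorem log_le_mul_sqrt {x : ℝ} (hx : 1000000 ≤ x) : Real.log x ≤ 0.014 * √x := by
  have hs : 1000 ≤ √x := Real.le_sqrt_of_sq_le (by norm_num; exact hx)
  have h1 : Real.log x = 2 * Real.log (√x) := by rw [Real.log_sqrt (by linarith)]; ring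
  have h2 := Real.log_le_sub_one_of_pos (x := √x / 1024) (by positivity)
  rw [Real.log_div (by positivity) (by norm_num), show (1024 : ℝ) = 2 ^ 10 by norm_num,
    Real.log_pow] at h2
  have h3 := Real.log_two_lt_d9
  norm_num at h2
  linarith

theorem theta_two_thirds_lt {x : ℝ} (hx : 1000000 ≤ x) :
    Chebyshev.theta (2 * x / 3) < Chebyshev.theta (x - 16) := by
  have hA := chebyshevConstant_gt
  set N := ⌊2 * x / 3⌋₊ with hN
  set M := ⌊x - 16⌋₊ with hM
  have hNx : (N : ℝ) ≤ 2 * x / 3 := Nat.floor_le (by linarith)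
  have hMx : (M : ℝ) ≤ x - 16 := Nat.floor_le (by linarith)
  have hMx' : x - 16 < M + 1 := Nat.lt_floor_add_one _
  have hN3 : 600000 ≤ N := Nat.le_floor (by norm_num; linarith)
  have hM3 : 600000 ≤ M := Nat.le_floor (by norm_num; linarith)
  have hN6 : ((N / 6 : ℕ) : ℝ) ≤ N / 6 := Nat.cast_div_le
  have hN36 : ((N / 6 / 6 : ℕ) : ℝ) ≤ ((N / 6 : ℕ) : ℝ) / 6 := Nat.cast_div_le
  have hlog : ∀ n : ℕ, 1 ≤ n → (n : ℝ) ≤ x → Real.log n ≤ 0.014 * √x := fun n h1 h2 =>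
    (Real.log_le_log (by exact_mod_cast h1) h2).trans (log_le_mul_sqrt hx)
  have lN := hlog N (by omega) (by linarith)
  have lM := hlog M (by omega) (by linarith)
  have lN6 := hlog (N / 6) (by omega) (by linarith)
  have dN := (abs_le.1 (abs_chebyshevQuotientLog_sub_le (N := N) (by omega))).2
  have dN6 := (abs_le.1 (abs_chebyshevQuotientLog_sub_le (N := N / 6) (by omega))).2
  have dM := (abs_le.1 (abs_chebyshevQuotientLog_sub_le (N := M) (by omega))).1
  have pN := psi_le_chebyshevQuotientLog_add N
  have pN6 := psi_le_chebyshevQuotientLog_add (N / 6)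
  have pN36 := Chebyshev.psi_le_const_mul_self (x := ((N / 6 / 6 : ℕ) : ℝ)) (by positivity)
  have pM := chebyshevQuotientLog_le_psi M
  have tM := Chebyshev.psi_sub_theta_le (x := M) (by exact_mod_cast (by omega : 1 ≤ M))
  have tN := Chebyshev.theta_le_psi N
  rw [Chebyshev.theta_eq_theta_coe_floor (2 * x / 3),
    Chebyshev.theta_eq_theta_coe_floor (x - 16), ← hN, ← hM]
  have hs : 1000 ≤ √x := Real.le_sqrt_of_sq_le (by norm_num; exact hx)
  have hss : √x * √x = x := Real.mul_self_sqrt (by linarith)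
  have hsM : 2 * √(M : ℝ) * Real.log M ≤ 0.028 * x := by
    have h1 : √(M : ℝ) ≤ √x := Real.sqrt_le_sqrt (by linarith)
    have h2 : √(M : ℝ) * Real.log M ≤ √x * (0.014 * √x) :=
      mul_le_mul h1 lM (Real.log_natCast_nonneg M) (by positivity)
    linarith
  have hsx : √x ≤ x / 1000 := by nlinarith
  have h4 : Real.log 4 ≤ 1.3863 := by
    rw [show (4 : ℝ) = 2 ^ 2 by norm_num, Real.log_pow]
    have := Real.log_two_lt_d9
    norm_num
    linarith
  have e36 : (Real.log 4 + 4) * ((N / 6 / 6 : ℕ) : ℝ) ≤ 5.3863 * (x / 54) :=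
    mul_le_mul (by linarith) (by linarith) (by positivity) (by norm_num)
  have eN : chebyshevConstant * N ≤ chebyshevConstant * (2 * x / 3) :=
    mul_le_mul_of_nonneg_left hNx (by linarith)
  have eN6 : chebyshevConstant * (N / 6 : ℕ) ≤ chebyshevConstant * (x / 9) :=
    mul_le_mul_of_nonneg_left (by linarith) (by linarith)
  have eM : chebyshevConstant * (x - 17) ≤ chebyshevConstant * M :=
    mul_le_mul_of_nonneg_left (by linarith) (by linarith)
  have eA : 0.76 * (2 * x / 9 - 17) ≤ chebyshevConstant * (2 * x / 9 - 17) :=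
    mul_le_mul_of_nonneg_right hA.le (by linarith)
  linarith

theorem exists_prime_of_theta_lt {a b : ℝ}
    (h : Chebyshev.theta a < Chebyshev.theta b) :
    ∃ p : ℕ, p.Prime ∧ a < (p : ℝ) ∧ (p : ℝ) ≤ b := by
  by_contra! hno
  refine h.not_ge ?_
  refine Finset.sum_le_sum_of_subset_of_nonneg (fun p hp => ?_)
    fun p _ _ => Real.log_natCast_nonneg p
  simp only [Finset.mem_filter, Finset.mem_Ioc] at hp ⊢
  refine ⟨⟨hp.1.1, Nat.le_floor ?_⟩, hp.2⟩
  by_contra! hlt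
  exact (hno p hp.2 hlt).not_ge ((Nat.le_floor_iff' hp.1.1.ne').1 hp.1.2)

/-- For every real `x ≥ 57`, the interval `(2x/3, x - 16]` contains a prime. -/
theorem exists_prime_between_two_thirds (x : ℝ) (hx : 57 ≤ x) :
    ∃ p : ℕ, p.Prime ∧ 2 * x / 3 < (p : ℝ) ∧ (p : ℝ) ≤ x - 16 := by
  rcases le_or_gt 1000000 x with hlarge | hsmall
  · exact exists_prime_of_theta_lt (theta_two_thirds_lt hlarge)
  by_contra! hno
  have le_of_prime : ∀ q : ℕ, q.Prime → (q : ℝ) ≤ x - 16 → 3 * (q : ℝ) ≤ 2 * x := by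
    intro q hq hqx
    by_contra! h
    exact (hno q hq (by linarith)).not_ge hqx
  have next : ∀ {p : ℕ} (q : ℕ), q.Prime → 2 * q + 32 ≤ 3 * p → 3 * (p : ℝ) ≤ 2 * x →
      3 * (q : ℝ) ≤ 2 * x := by
    intro p q hq hqp h
    have hqp' : 2 * (q : ℝ) + 32 ≤ 3 * p := by exact_mod_cast hqp
    exact le_of_prime q hq (by linarith)
  have h := le_of_prime 41 (by norm_num) (by norm_num; linarith)
  replace h := next 43 (by norm_num) (by norm_num) h
  replace h := next 47 (by norm_num) (by norm_num) h
  replace h := next 53 (by norm_num) (by norm_num) h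
  replace h := next 61 (by norm_num) (by norm_num) h
  replace h := next 73 (by norm_num) (by norm_num) h
  replace h := next 89 (by norm_num) (by norm_num) h
  replace h := next 113 (by norm_num) (by norm_num) h
  replace h := next 151 (by norm_num) (by norm_num) h
  replace h := next 199 (by norm_num) (by norm_num) h
  replace h := next 281 (by norm_num) (by norm_num) h
  replace h := next 401 (by norm_num) (by norm_num) h
  replace h := next 577 (by norm_num) (by norm_num) h
  replace h := next 839 (by norm_num) (by norm_num) h
  replace h := next 1237 (by norm_num) (by norm_num) h
  replace h := next 1831 (by norm_num) (by norm_num) h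
  replace h := next 2729 (by norm_num) (by norm_num) h
  replace h := next 4073 (by norm_num) (by norm_num) h
  replace h := next 6091 (by norm_num) (by norm_num) h
  replace h := next 9109 (by norm_num) (by norm_num) h
  replace h := next 13633 (by norm_num) (by norm_num) h
  replace h := next 20431 (by norm_num) (by norm_num) h
  replace h := next 30593 (by norm_num) (by norm_num) h
  replace h := next 45869 (by norm_num) (by norm_num) h
  replace h := next 68777 (by norm_num) (by norm_num) h
  replace h := next 103141 (by norm_num) (by norm_num) h
  replace h := next 154691 (by norm_num) (by norm_num) h
  replace h := next 232013 (by norm_num) (by norm_num) h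
  replace h := next 348001 (by norm_num) (by norm_num) h
  replace h := next 521981 (by norm_num) (by norm_num) h
  replace h := next 782941 (by norm_num) (by norm_num) h
  norm_num at h
  linarith
end

section
/- Let p be a prime, q = p^m a prime power with q > 3, and n ≥ 5. Then S = SL_n(F_q) contains an element g such that: (1) the order of g is coprime to p (g is semisimple); (2) p times the order of g is not the order of any element of S (the order of g is p-maximal); (3) the cyclic subgroup generated by g intersects the center of S trivially; and (4) for every 0 ≤ j ≤ n, there is a multiset of j pairwise distinct roots, in an algebraic closure of F_q, of the characteristic polynomial of g whose product equals 1. -/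
section Zsigmondy

open Polynomial

lemma isPrimitiveRoot_of_dvd_cyclotomic_eval {q e l : ℕ} [Fact l.Prime] (he : e ≠ 0)
    (hl : (l : ℤ) ∣ (cyclotomic e ℤ).eval (q : ℤ)) :
    ∃ a m : ℕ, ¬ l ∣ m ∧ e = l ^ a * m ∧ orderOf (q : ZMod l) = m ∧ m ∣ l - 1 := by
  obtain ⟨a, m, hm, rfl⟩ := Nat.exists_eq_pow_mul_and_not_dvd he l (Fact.out : l.Prime).ne_one
  have : NeZero (m : ZMod l) := ⟨by rwa [Ne, ZMod.natCast_eq_zero_iff]⟩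
  have hr : (cyclotomic (l ^ a * m) (ZMod l)).IsRoot (q : ZMod l) := by
    rw [← map_cyclotomic_int, IsRoot.def, eval_map]
    have := eval₂_at_apply (p := cyclotomic (l ^ a * m) ℤ) (Int.castRingHom (ZMod l)) (q : ℤ)
    simp only [eq_intCast, Int.cast_natCast] at this
    rw [this, ZMod.intCast_zmod_eq_zero_iff_dvd]
    exact hl
  rw [isRoot_cyclotomic_prime_pow_mul_iff_of_charP] at hr
  refine ⟨a, m, hm, rfl, hr.eq_orderOf.symm, ?_⟩
  rw [hr.eq_orderOf]
  refine ZMod.orderOf_dvd_card_sub_one ?_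
  rintro h0
  have := hr.pow_eq_one
  rw [h0, zero_pow (by rintro rfl; simp at hm)] at this
  exact zero_ne_one this

lemma not_sq_dvd_cyclotomic_eval {q e l a m : ℕ} [Fact l.Prime] (he : 3 ≤ e) (hq : 2 ≤ q)
    (ha : a ≠ 0) (hem : e = l ^ a * m) (ho : orderOf (q : ZMod l) = m) (hml : m ∣ l - 1) :
    ¬ (l : ℤ) ^ 2 ∣ (cyclotomic e ℤ).eval (q : ℤ) := by
  have hlp : l.Prime := Fact.out
  obtain ⟨b, rfl⟩ := Nat.exists_eq_succ_of_ne_zero ha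
  obtain ⟨e', he'⟩ : ∃ e', e' = l ^ b * m := ⟨_, rfl⟩
  have hee : e = e' * l := by rw [hem, he', pow_succ]; ring
  have he'0 : e' ≠ 0 := by rintro h; rw [h] at hee; omega
  set x : ℤ := (q : ℤ) ^ e' with hx
  have hx1 : (l : ℤ) ∣ x - 1 := by
    rw [← ZMod.intCast_zmod_eq_zero_iff_dvd]
    push_cast [hx]
    rw [sub_eq_zero, ← orderOf_dvd_iff_pow_eq_one, ho]
    exact Dvd.intro_left _ he'.symm
  have hxl : ¬ (l : ℤ) ∣ x := fun h => by
    have := dvd_sub h hx1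
    simp only [sub_sub_cancel] at this
    exact hlp.one_lt.ne' (by exact_mod_cast Int.eq_one_of_dvd_one (by positivity) this)
  have hx0 : x - 1 ≠ 0 := by
    have : 1 < x := one_lt_pow₀ (by exact_mod_cast hq) he'0
    omega
  have hdvd : (cyclotomic e ℤ).eval (q : ℤ) ∣ ∑ i ∈ Finset.range l, x ^ i := by
    have h1 := X_pow_sub_one_mul_cyclotomic_dvd_X_pow_sub_one_of_dvd ℤ (d := e') (n := e)
      (by
        rw [Nat.mem_properDivisors]
        refine ⟨⟨l, hee⟩, ?_⟩
        rw [hee]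
        exact lt_mul_of_one_lt_right (Nat.pos_of_ne_zero he'0) hlp.one_lt)
    have h2 := eval_dvd (x := (q : ℤ)) h1
    simp only [eval_mul, eval_sub, eval_pow, eval_X, eval_one] at h2
    rw [hee, pow_mul, ← hx, ← mul_geom_sum x l] at h2
    rw [hee]
    exact (mul_dvd_mul_iff_left hx0).1 h2
  intro hsq
  have hsq := hsq.trans hdvd
  rcases hlp.eq_two_or_odd' with rfl | hodd
  · have hm1 : m = 1 := by simpa using hml
    have hb : b ≠ 0 := by
      rintro rfl
      simp [hm1] at hem
      omega
    obtain ⟨c, rfl⟩ := Nat.exists_eq_succ_of_ne_zero hb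
    have hsqx : x = ((q : ℤ) ^ (2 ^ c)) ^ 2 := by
      rw [hx, he', hm1, mul_one, ← pow_mul, pow_succ]
    have hodd : Odd ((q : ℤ) ^ (2 ^ c)) := by
      rw [← Int.not_even_iff_odd, even_iff_two_dvd]
      intro h
      apply hxl
      rw [hsqx]
      exact dvd_pow h two_ne_zero
    have := Int.sq_mod_four_eq_one_of_odd hodd
    rw [← hsqx] at this
    simp [Finset.sum_range_succ] at hsq
    omega
  · have h := emultiplicity_geom_sum₂_eq_one (R := ℤ) (p := l) (x := x) (y := 1)
      (Nat.prime_iff_prime_int.1 hlp) hodd hx1 hxl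
    simp only [one_pow, mul_one] at h
    have := le_emultiplicity_of_pow_dvd hsq
    rw [h] at this
    norm_num at this

/-- Zsigmondy's theorem for exponents at least `3` and bases at least `4`. -/
theorem exists_prime_orderOf_eq {q e : ℕ} (hq : 4 ≤ q) (he : 3 ≤ e) :
    ∃ l : ℕ, l.Prime ∧ orderOf (q : ZMod l) = e := by
  by_contra! H
  set V := ((cyclotomic e ℤ).eval (q : ℤ)).natAbs with hV
  have hVlt : (q - 1) ^ e.totient < V :=
    sub_one_pow_totient_lt_natAbs_cyclotomic_eval (by omega) (by omega)
  have hV1 : V ≠ 1 := by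
    have : 0 < (q - 1) ^ e.totient := Nat.pow_pos (by omega)
    omega
  have key : ∀ l : ℕ, l.Prime → l ∣ V → l ∣ e ∧ (∀ r : ℕ, r.Prime → r ∣ e → r ≤ l) ∧
      ¬ l ^ 2 ∣ V := by
    intro l hl hlV
    have : Fact l.Prime := ⟨hl⟩
    obtain ⟨a, m, hlm, hem, ho, hml⟩ := isPrimitiveRoot_of_dvd_cyclotomic_eval (q := q) (e := e)
      (by omega) (Int.natCast_dvd.2 hlV)
    have ha : a ≠ 0 := by
      rintro rfl
      rw [pow_zero, one_mul] at hem
      exact H l hl (by rw [ho, hem])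
    refine ⟨hem ▸ Dvd.dvd.mul_right (dvd_pow_self _ ha) _, fun r hr hre => ?_, fun h => ?_⟩
    · rw [hem, hr.dvd_mul] at hre
      rcases hre with h | h
      · exact Nat.le_of_dvd hl.pos (hr.dvd_of_dvd_pow h)
      · have h1 := Nat.le_of_dvd (Nat.sub_pos_of_lt hl.one_lt) (h.trans hml)
        omega
    · refine not_sq_dvd_cyclotomic_eval he (by omega) ha hem ho hml ?_
      have := Int.natCast_dvd.2 h
      exact_mod_cast this
  obtain ⟨l, hl, hlV⟩ := Nat.exists_prime_and_dvd hV1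
  obtain ⟨hle, hmax, hsq⟩ := key l hl hlV
  obtain ⟨w, hw⟩ := hlV
  have hw1 : w = 1 := by
    by_contra hw1
    obtain ⟨r, hr, hrw⟩ := Nat.exists_prime_and_dvd hw1
    obtain ⟨hre, hmaxr, -⟩ := key r hr (hw ▸ hrw.mul_left l)
    obtain rfl : r = l := le_antisymm (hmax r hr hre) (hmaxr l hl hle)
    apply hsq
    rw [hw, sq]
    exact Nat.mul_dvd_mul_left r hrw
  rw [hw1, mul_one] at hw
  have h1 : l - 1 ≤ e.totient := by
    rw [← Nat.totient_prime hl]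
    exact Nat.le_of_dvd (Nat.totient_pos.2 (by omega)) (Nat.totient_dvd_of_dvd hle)
  have h2 : 2 ^ (l - 1) ≤ (q - 1) ^ e.totient :=
    (Nat.pow_le_pow_right (by omega) h1).trans (Nat.pow_le_pow_left (by omega) _)
  have h3 : l - 1 < 2 ^ (l - 1) := Nat.lt_two_pow_self
  omega

end Zsigmondy

section Factors

open Polynomial UniqueFactorizationMonoid

lemma Multiset.nodup_of_sum_map_le {α : Type*} {G : Multiset α} {d : α → ℕ}
    (hG : ∀ g ∈ G, 1 ≤ d g) {S : Finset α} (hS : ∀ g ∈ S, g ∈ G ∧ 2 ≤ d g)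
    (hsum : (G.map d).sum ≤ ∑ g ∈ S, d g + 1) : G.Nodup := by
  have hle : S.val ≤ G := (Multiset.le_iff_subset S.nodup).2 fun g hg => (hS g hg).1
  obtain ⟨T, rfl⟩ := Multiset.le_iff_exists_add.1 hle
  have hs : ∑ g ∈ S, d g = (S.val.map d).sum := rfl
  rw [Multiset.map_add, Multiset.sum_add, ← hs] at hsum
  have hT : (T.map d).sum ≤ 1 := by omega
  have hTd : ∀ g ∈ T, d g ≤ 1 := fun g hg =>
    (Multiset.le_sum_of_mem (Multiset.mem_map_of_mem d hg)).trans hT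
  have hcard : T.card ≤ 1 := by
    refine le_trans ?_ hT
    have := Multiset.card_nsmul_le_sum (s := T.map d) (a := 1) (by
      intro x hx
      obtain ⟨g, hg, rfl⟩ := Multiset.mem_map.1 hx
      exact hG g (Multiset.mem_add.2 (Or.inr hg)))
    simpa using this
  refine Multiset.nodup_add.2 ⟨S.nodup, ?_, ?_⟩
  · rcases Nat.le_one_iff_eq_zero_or_eq_one.1 hcard with h | h
    · rw [Multiset.card_eq_zero.1 h]
      exact Multiset.nodup_zero
    · obtain ⟨a, rfl⟩ := Multiset.card_eq_one.1 h
      exact Multiset.nodup_singleton a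
  · rw [Multiset.disjoint_left]
    intro g hgS hgT
    have h1 := hTd g hgT
    have h2 := (hS g hgS).2
    omega

variable {F : Type*} [Field F] {n : ℕ}

lemma SL_pow_eq_one_of_charpoly_dvd (h : Matrix.SpecialLinearGroup (Fin n) F) {N : ℕ}
    (hN : (h : Matrix (Fin n) (Fin n) F).charpoly ∣ X ^ N - 1) : h ^ N = 1 := by
  obtain ⟨c, hc⟩ := hN
  have := congrArg (aeval (h : Matrix (Fin n) (Fin n) F)) hc
  rw [map_mul, Matrix.aeval_self_charpoly, zero_mul] at this
  apply Matrix.SpecialLinearGroup.ext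
  intro i j
  have h2 : (h : Matrix (Fin n) (Fin n) F) ^ N = 1 := by simpa [sub_eq_zero] using this
  simp [h2]

variable [DecidableEq F]

lemma not_dvd_X_of_mem_normalizedFactors_charpoly (h : Matrix.SpecialLinearGroup (Fin n) F)
    {g : F[X]} (hg : g ∈ normalizedFactors (h : Matrix (Fin n) (Fin n) F).charpoly) :
    ¬ g ∣ X := by
  intro hgX
  have hX : X ∣ (h : Matrix (Fin n) (Fin n) F).charpoly :=
    ((irreducible_of_normalized_factor g hg).associated_of_dvd irreducible_X hgX).symm.dvd.trans
      (dvd_of_mem_normalizedFactors hg)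
  rw [X_dvd_iff] at hX
  have := Matrix.det_eq_sign_charpoly_coeff (h : Matrix (Fin n) (Fin n) F)
  rw [hX, mul_zero, h.det_coe] at this
  exact one_ne_zero this

lemma sum_natDegree_normalizedFactors_charpoly (A : Matrix (Fin n) (Fin n) F) :
    ((normalizedFactors A.charpoly).map natDegree).sum = n := by
  have hf0 : A.charpoly ≠ 0 := (Matrix.charpoly_monic _).ne_zero
  rw [← natDegree_multiset_prod _ (zero_notMem_normalizedFactors _),
    natDegree_eq_of_degree_eq (degree_eq_degree_of_associated (prod_normalizedFactors hf0)),
    Matrix.charpoly_natDegree_eq_dim, Fintype.card_fin]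

lemma nodup_normalizedFactors_charpoly_of_sum_le {A : Matrix (Fin n) (Fin n) F}
    {S : Finset F[X]} (hS : ∀ g ∈ S, g ∈ normalizedFactors A.charpoly ∧ 2 ≤ g.natDegree)
    (hsum : n ≤ ∑ g ∈ S, g.natDegree + 1) : (normalizedFactors A.charpoly).Nodup :=
  Multiset.nodup_of_sum_map_le
    (fun g hg => (irreducible_of_normalized_factor g hg).natDegree_pos) hS
    (by rwa [sum_natDegree_normalizedFactors_charpoly])

lemma natDegree_le_of_mem_normalizedFactors_charpoly {A : Matrix (Fin n) (Fin n) F} {g : F[X]}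
    (hg : g ∈ normalizedFactors A.charpoly) : g.natDegree ≤ n := by
  rw [← sum_natDegree_normalizedFactors_charpoly A]
  exact Multiset.le_sum_of_mem (Multiset.mem_map_of_mem _ hg)

lemma natDegree_add_le_of_mem_normalizedFactors_charpoly {A : Matrix (Fin n) (Fin n) F}
    {g g' : F[X]} (hg : g ∈ normalizedFactors A.charpoly)
    (hg' : g' ∈ normalizedFactors A.charpoly) (hne : g ≠ g') :
    g.natDegree + g'.natDegree ≤ n := by
  rw [← sum_natDegree_normalizedFactors_charpoly A]
  obtain ⟨T, hT⟩ := Multiset.exists_cons_of_mem hg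
  have hg2 : g' ∈ T := by
    rw [hT] at hg'
    exact (Multiset.mem_cons.1 hg').resolve_left hne.symm
  rw [hT, Multiset.map_cons, Multiset.sum_cons]
  exact Nat.add_le_add_left (Multiset.le_sum_of_mem (Multiset.mem_map_of_mem _ hg2)) _

variable [Fintype F]

local notation "q" => Fintype.card F

lemma mem_normalizedFactors_dvd_X_pow_sub_one (h : Matrix.SpecialLinearGroup (Fin n) F)
    {g : F[X]} (hg : g ∈ normalizedFactors (h : Matrix (Fin n) (Fin n) F).charpoly) {K : ℕ}
    (hK : q ^ g.natDegree - 1 ∣ K) : g ∣ X ^ K - 1 := by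
  have hirr := irreducible_of_normalized_factor g hg
  have h1 : g ∣ X ^ q ^ g.natDegree - X := by
    have := hirr.natDegree_dvd_iff_dvd_X_pow_card_pow_sub_X.1 (dvd_refl _)
    rwa [Nat.card_eq_fintype_card] at this
  have h2 : (X ^ q ^ g.natDegree - X : F[X]) = X * (X ^ (q ^ g.natDegree - 1) - 1) := by
    have : q ^ g.natDegree = (q ^ g.natDegree - 1) + 1 :=
      (Nat.sub_add_cancel (Nat.one_le_pow _ _ Fintype.card_pos)).symm
    conv_lhs => rw [this]
    ring
  rw [h2] at h1
  refine ((hirr.prime.dvd_or_dvd h1).resolve_left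
    (not_dvd_X_of_mem_normalizedFactors_charpoly h hg)).trans ?_
  obtain ⟨c, rfl⟩ := hK
  rw [pow_mul]
  exact sub_one_dvd_pow_sub_one _ _

lemma orderOf_dvd_mul_pow_of_degrees (h : Matrix.SpecialLinearGroup (Fin n) F) {K : ℕ}
    (hK : ∀ g ∈ normalizedFactors (h : Matrix (Fin n) (Fin n) F).charpoly,
      q ^ g.natDegree - 1 ∣ K) : ∃ M : ℕ, orderOf h ∣ K * q ^ M := by
  set f := (h : Matrix (Fin n) (Fin n) F).charpoly with hf
  have hf0 : f ≠ 0 := (Matrix.charpoly_monic _).ne_zero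
  refine ⟨(normalizedFactors f).card, orderOf_dvd_of_pow_eq_one
    (SL_pow_eq_one_of_charpoly_dvd h ?_)⟩
  rw [← hf]
  refine (prod_normalizedFactors hf0).symm.dvd.trans ?_
  have h1 : (normalizedFactors f).prod ∣ (X ^ K - 1) ^ (normalizedFactors f).card := by
    have := Multiset.prod_dvd_prod_of_dvd (S := normalizedFactors f) (fun g => g)
      (fun _ => (X ^ K - 1 : F[X]))
      (fun g hg => mem_normalizedFactors_dvd_X_pow_sub_one h hg (hK g hg))
    simpa using this
  refine h1.trans ?_
  obtain ⟨p, hp⟩ := CharP.exists F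
  have : Fact p.Prime := ⟨CharP.char_is_prime F p⟩
  obtain ⟨m, -, hm⟩ := FiniteField.card F p
  have h2 : ((X ^ K - 1 : F[X])) ^ q ^ (normalizedFactors f).card
      = X ^ (K * q ^ (normalizedFactors f).card) - 1 := by
    rw [hm, ← pow_mul p, sub_pow_char_pow, one_pow, ← pow_mul]
  rw [← h2]
  exact pow_dvd_pow _ (Nat.lt_pow_self Fintype.one_lt_card).le

lemma SL_orderOf_coprime_of_nodup (h : Matrix.SpecialLinearGroup (Fin n) F)
    (hnd : (normalizedFactors (h : Matrix (Fin n) (Fin n) F).charpoly).Nodup) :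
    (orderOf h).Coprime q := by
  set f := (h : Matrix (Fin n) (Fin n) F).charpoly with hf
  have hf0 : f ≠ 0 := (Matrix.charpoly_monic _).ne_zero
  set N := ((normalizedFactors f).map natDegree).prod with hN
  have hN0 : N ≠ 0 := by
    rw [hN, Ne, Multiset.prod_eq_zero_iff]
    intro h0
    obtain ⟨g, hg, h0⟩ := Multiset.mem_map.1 h0
    exact (irreducible_of_normalized_factor g hg).natDegree_pos.ne' h0
  have hqN : q ^ N - 1 ≠ 0 := by
    have := Nat.one_lt_pow hN0 (Fintype.one_lt_card (α := F))
    omega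
  have hP0 : (X ^ (q ^ N - 1) - 1 : F[X]) ≠ 0 := (monic_X_pow_sub_C 1 hqN).ne_zero
  have hdvd : f ∣ X ^ (q ^ N - 1) - 1 := by
    rw [dvd_iff_normalizedFactors_le_normalizedFactors hf0 hP0, Multiset.le_iff_subset hnd]
    intro g hg
    rw [mem_normalizedFactors_iff' hP0]
    refine ⟨irreducible_of_normalized_factor g hg, normalize_normalized_factor g hg,
      mem_normalizedFactors_dvd_X_pow_sub_one h hg ?_⟩
    exact Nat.pow_sub_one_dvd_pow_sub_one _ (Multiset.dvd_prod (Multiset.mem_map_of_mem _ hg))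
  have ho := orderOf_dvd_of_pow_eq_one (SL_pow_eq_one_of_charpoly_dvd h hdvd)
  refine Nat.Coprime.coprime_dvd_left ho ?_
  have : (q ^ N - 1).Coprime (q ^ N) := by
    obtain ⟨t, ht⟩ := Nat.exists_eq_add_of_le' (Nat.one_le_pow N q Fintype.card_pos)
    rw [ht]
    simp
  exact Nat.Coprime.coprime_dvd_right (dvd_pow_self _ hN0) this

lemma exists_dvd_natDegree_of_prime_dvd_orderOf (h : Matrix.SpecialLinearGroup (Fin n) F) {l e : ℕ}
    (hl : l.Prime) (he : e ≠ 0) (ho : orderOf (q : ZMod l) = e) (hlh : l ∣ orderOf h) :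
    ∃ g ∈ normalizedFactors (h : Matrix (Fin n) (Fin n) F).charpoly, e ∣ g.natDegree := by
  have : Fact l.Prime := ⟨hl⟩
  obtain ⟨M, hM⟩ := orderOf_dvd_mul_pow_of_degrees h
    (K := ((normalizedFactors (h : Matrix (Fin n) (Fin n) F).charpoly).map
      fun g => q ^ g.natDegree - 1).prod)
    (fun g hg => Multiset.dvd_prod (Multiset.mem_map.2 ⟨g, hg, rfl⟩))
  rcases hl.dvd_mul.1 (hlh.trans hM) with h1 | h1
  · obtain ⟨a, ha, hla⟩ := hl.prime.exists_mem_multiset_dvd h1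
    obtain ⟨g, hg, rfl⟩ := Multiset.mem_map.1 ha
    refine ⟨g, hg, ?_⟩
    rw [← ho, orderOf_dvd_iff_pow_eq_one]
    rw [← ZMod.natCast_eq_zero_iff, Nat.cast_sub (Nat.one_le_pow _ _ Fintype.card_pos)] at hla
    simpa [sub_eq_zero] using hla
  · have h2 := hl.dvd_of_dvd_pow h1
    rw [← ZMod.natCast_eq_zero_iff] at h2
    rw [h2, orderOf_zero] at ho
    exact (he ho.symm).elim

/-- An element whose order is divisible by a primitive prime divisor of `q ^ (n - 1) - 1` is
regular semisimple. -/
lemma nodup_of_prime_dvd_orderOf (h : Matrix.SpecialLinearGroup (Fin n) F) {l e : ℕ}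
    (hl : l.Prime) (he : 2 ≤ e) (hn : n = e + 1) (ho : orderOf (q : ZMod l) = e)
    (hlh : l ∣ orderOf h) :
    (normalizedFactors (h : Matrix (Fin n) (Fin n) F).charpoly).Nodup := by
  obtain ⟨g, hg, hd⟩ := exists_dvd_natDegree_of_prime_dvd_orderOf h hl (by omega) ho hlh
  have := Nat.le_of_dvd (irreducible_of_normalized_factor g hg).natDegree_pos hd
  refine nodup_normalizedFactors_charpoly_of_sum_le (S := {g}) ?_ ?_
  · simpa using ⟨hg, by omega⟩
  · simp; omega

lemma nodup_of_primes_dvd_orderOf (h : Matrix.SpecialLinearGroup (Fin n) F) {l l' d e : ℕ}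
    (hl : l.Prime) (hl' : l'.Prime) (hd : 3 ≤ d) (he : 3 ≤ e) (hde : d.Coprime e)
    (hn : n = d + e + 1) (ho : orderOf (q : ZMod l) = d) (ho' : orderOf (q : ZMod l') = e)
    (hlh : l ∣ orderOf h) (hlh' : l' ∣ orderOf h) :
    (normalizedFactors (h : Matrix (Fin n) (Fin n) F).charpoly).Nodup := by
  obtain ⟨g, hg, hgd⟩ := exists_dvd_natDegree_of_prime_dvd_orderOf h hl (by omega) ho hlh
  obtain ⟨g', hg', hge⟩ := exists_dvd_natDegree_of_prime_dvd_orderOf h hl' (by omega) ho' hlh'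
  have h1 := Nat.le_of_dvd (irreducible_of_normalized_factor g hg).natDegree_pos hgd
  have h2 := Nat.le_of_dvd (irreducible_of_normalized_factor g' hg').natDegree_pos hge
  have hne : g ≠ g' := by
    rintro rfl
    have h3 := Nat.le_of_dvd (irreducible_of_normalized_factor g hg).natDegree_pos
      (hde.mul_dvd_of_dvd_of_dvd hgd hge)
    have h4 := natDegree_le_of_mem_normalizedFactors_charpoly hg
    nlinarith
  refine nodup_normalizedFactors_charpoly_of_sum_le (S := {g, g'}) ?_ ?_
  · simp only [Finset.mem_insert, Finset.mem_singleton]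
    rintro k (rfl | rfl)
    · exact ⟨hg, by omega⟩
    · exact ⟨hg', by omega⟩
  · rw [Finset.sum_pair hne]; omega

lemma nodup_of_dvd_orderOf_six (h : Matrix.SpecialLinearGroup (Fin 6) F) {l : ℕ}
    (hq : 3 < q) (hl : l.Prime) (ho : orderOf (q : ZMod l) = 3)
    (hlh : l ∣ orderOf h) (hlh' : q + 1 ∣ orderOf h) :
    (normalizedFactors (h : Matrix (Fin 6) (Fin 6) F).charpoly).Nodup := by
  obtain ⟨g, hg, hgd⟩ := exists_dvd_natDegree_of_prime_dvd_orderOf h hl (by omega) ho hlh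
  have hpos := (irreducible_of_normalized_factor g hg).natDegree_pos
  have hle := natDegree_le_of_mem_normalizedFactors_charpoly hg
  obtain ⟨g', hg', hge⟩ : ∃ g' ∈ normalizedFactors (h : Matrix (Fin 6) (Fin 6) F).charpoly,
      ¬ g'.natDegree ∣ 3 := by
    by_contra! H
    obtain ⟨M, hM⟩ := orderOf_dvd_mul_pow_of_degrees h (K := q ^ 3 - 1)
      (fun g hg => Nat.pow_sub_one_dvd_pow_sub_one _ (H g hg))
    have h1 : q + 1 ∣ q ^ 3 - 1 := by
      refine Nat.Coprime.dvd_of_dvd_mul_right (k := q + 1) (n := q ^ M) ?_ (hlh'.trans hM)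
      exact Nat.Coprime.pow_right _ (by simp)
    have h2 : q + 1 ∣ 2 := by
      have h3 : q ^ 3 - 1 + 2 = (q + 1) * (q ^ 2 - q + 1) := by
        have := Nat.one_le_pow 3 q Fintype.card_pos
        have : q ≤ q ^ 2 := Nat.le_self_pow two_ne_zero _
        zify [*]
        ring
      exact (Nat.dvd_add_right h1).1 (h3 ▸ Dvd.intro _ rfl)
    have := Nat.le_of_dvd two_pos h2
    omega
  have hpos' := (irreducible_of_normalized_factor g' hg').natDegree_pos
  by_cases h6 : g.natDegree = 3
  · have hne : g ≠ g' := by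
      rintro rfl
      exact hge (by rw [h6])
    have hadd := natDegree_add_le_of_mem_normalizedFactors_charpoly hg hg' hne
    have h2' : 2 ≤ g'.natDegree := by
      by_contra! hlt
      exact hge (by rw [show g'.natDegree = 1 by omega]; simp)
    refine nodup_normalizedFactors_charpoly_of_sum_le (S := {g, g'}) ?_ ?_
    · simp only [Finset.mem_insert, Finset.mem_singleton]
      rintro k (rfl | rfl)
      · exact ⟨hg, by omega⟩
      · exact ⟨hg', by omega⟩
    · rw [Finset.sum_pair hne]; omega
  · refine nodup_normalizedFactors_charpoly_of_sum_le (S := {g}) ?_ ?_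
    · simpa using ⟨hg, by omega⟩
    · simp; omega

end Factors

section Construction

open Polynomial UniqueFactorizationMonoid

lemma exists_matrix_charpoly_eq {F : Type*} [Field F] {n : ℕ} {f : F[X]} (hf : f.Monic)
    (hn : f.natDegree = n) : ∃ A : Matrix (Fin n) (Fin n) F, A.charpoly = f ∧
      ∀ P : F[X], aeval A P = 0 → f ∣ P := by
  subst hn
  let pb := AdjoinRoot.powerBasis' hf
  have hgen : pb.gen = AdjoinRoot.root f := rfl
  refine ⟨Algebra.leftMulMatrix pb.basis pb.gen, ?_, fun P hP => ?_⟩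
  · have := charpoly_leftMulMatrix pb
    rw [hgen, AdjoinRoot.minpoly_root hf.ne_zero, hf.leadingCoeff, inv_one, C_1, mul_one] at this
    exact this
  · have h1 := aeval_algHom_apply (Algebra.leftMulMatrix pb.basis) pb.gen P
    have h2 : Algebra.leftMulMatrix pb.basis (aeval pb.gen P) = 0 := h1.symm.trans hP
    rw [map_eq_zero_iff _ (Algebra.leftMulMatrix_injective pb.basis), hgen,
      AdjoinRoot.aeval_eq, AdjoinRoot.mk_eq_zero] at h2
    exact h2

variable {F : Type*} [Field F] [Fintype F]

local notation "q" => Fintype.card F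

lemma exists_SL_of_charpoly {n r : ℕ} {f : F[X]} (hf : f.Monic) (hn : f.natDegree = n)
    (hf1 : f.eval 1 = 0)
    (hprod : ∀ j ≤ n, ∃ s : Finset (AlgebraicClosure F), s.card = j ∧ (∀ x ∈ s, aeval x f = 0) ∧ ∏ x ∈ s, x = 1)
    (hr : ∀ N : ℕ, f ∣ X ^ N - 1 → r ∣ N)
    (hmax : ∀ h : Matrix.SpecialLinearGroup (Fin n) F, r ∣ orderOf h → (orderOf h).Coprime q) :
    ∃ g : Matrix.SpecialLinearGroup (Fin n) F,
      Nat.Coprime (orderOf g) q ∧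
      (∀ p : ℕ, p.Prime → p ∣ q →
        ¬ ∃ h : Matrix.SpecialLinearGroup (Fin n) F, orderOf h = p * orderOf g) ∧
      Subgroup.zpowers g ⊓ Subgroup.center (Matrix.SpecialLinearGroup (Fin n) F) = ⊥ ∧
      ∀ j : ℕ, j ≤ n → ∃ s : Finset (AlgebraicClosure F),
        s.card = j ∧
        (∀ x ∈ s, aeval x (Matrix.charpoly (g : Matrix (Fin n) (Fin n) F)) = 0) ∧
        ∏ x ∈ s, x = 1 := by
  obtain ⟨A, hA, hmin⟩ := exists_matrix_charpoly_eq hf hn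
  obtain ⟨R, hRcard, hRroot, hRprod⟩ := hprod n le_rfl
  have hmap0 : f.map (algebraMap F (AlgebraicClosure F)) ≠ 0 := (hf.map _).ne_zero
  have hroots : (f.map (algebraMap F (AlgebraicClosure F))).roots = R.val := by
    refine (Multiset.eq_of_le_of_card_le ((Multiset.le_iff_subset R.nodup).2 ?_) ?_).symm
    · intro x hx
      rw [mem_roots hmap0, IsRoot.def, eval_map_algebraMap]
      exact hRroot x hx
    · refine (card_roots' _).trans ?_
      rw [natDegree_map, hn, ← hRcard]
      rfl
  have hdet : A.det = 1 := by
    apply (algebraMap F (AlgebraicClosure F)).injective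
    rw [RingHom.map_det, Matrix.det_eq_prod_roots_charpoly, RingHom.mapMatrix_apply,
      Matrix.charpoly_map, hA, hroots, map_one, ← hRprod]
    simp
  let g : Matrix.SpecialLinearGroup (Fin n) F := ⟨A, hdet⟩
  have hg : (g : Matrix (Fin n) (Fin n) F) = A := rfl
  have hrg : r ∣ orderOf g := by
    refine hr _ (hmin _ ?_)
    have := congrArg (fun B : Matrix.SpecialLinearGroup (Fin n) F =>
      (B : Matrix (Fin n) (Fin n) F)) (pow_orderOf_eq_one g)
    simp only [Matrix.SpecialLinearGroup.coe_pow, hg, Matrix.SpecialLinearGroup.coe_one] at this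
    simp [this]
  refine ⟨g, hmax g hrg, ?_, ?_, ?_⟩
  · rintro p hp hpq ⟨h, hh⟩
    have h1 := hmax h (hrg.trans (hh ▸ Dvd.intro_left p rfl))
    exact hp.one_lt.ne' (Nat.eq_one_of_dvd_coprimes h1 (hh ▸ Dvd.intro _ rfl) hpq)
  · rw [eq_bot_iff]
    rintro z ⟨hz1, hz2⟩
    obtain ⟨i, rfl⟩ := (mem_powers_iff_mem_zpowers (x := g)).2 hz1
    obtain ⟨c, -, hc⟩ := Matrix.SpecialLinearGroup.mem_center_iff.1 hz2
    have hgi : A ^ i = Matrix.scalar (Fin n) c := by rw [hc]; simp [hg]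
    have hd : f ∣ X ^ i - C c := hmin _ (by
      simp [hgi, Matrix.algebraMap_eq_diagonal, Matrix.scalar_apply])
    have h1 := eval_dvd (x := (1 : F)) hd
    rw [hf1, zero_dvd_iff] at h1
    have hc1 : c = 1 := by
      simp only [eval_sub, eval_pow, eval_X, one_pow, eval_C, sub_eq_zero] at h1
      exact h1.symm
    rw [Subgroup.mem_bot]
    apply Matrix.SpecialLinearGroup.ext
    intro a b
    have : ((g ^ i : Matrix.SpecialLinearGroup (Fin n) F) : Matrix (Fin n) (Fin n) F) = 1 := by
      rw [← hc, hc1, map_one]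
    simpa using congrFun (congrFun this a) b
  · rw [hg, hA]
    exact hprod

open Classical in
/-- The orbit of `y` under the `q`-power Frobenius, when it has length `e`. -/
noncomputable def frobeniusOrbit (y : AlgebraicClosure F) (e : ℕ) : Finset (AlgebraicClosure F) :=
  (Finset.range e).image fun i => y ^ q ^ i

lemma aeval_pow_card_pow_eq_zero {y : AlgebraicClosure F} {f : F[X]} (h : aeval y f = 0) (i : ℕ) :
    aeval (y ^ q ^ i) f = 0 := by
  induction i with
  | zero => simpa using h
  | succ i ih =>
    rw [pow_succ, pow_mul, ← expand_aeval, FiniteField.expand_card, map_pow, ih,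
      zero_pow Fintype.card_ne_zero]

lemma aeval_minpoly_of_mem_frobeniusOrbit {y z : AlgebraicClosure F} {e : ℕ} (hz : z ∈ frobeniusOrbit y e) :
    aeval z (minpoly F y) = 0 := by
  classical
  obtain ⟨i, -, rfl⟩ := Finset.mem_image.1 hz
  exact aeval_pow_card_pow_eq_zero (minpoly.aeval F y) i

lemma Nat.coprime_of_orderOf_ne_zero {a c : ℕ} (h : orderOf (a : ZMod c) ≠ 0) : a.Coprime c := by
  rw [← ZMod.isUnit_iff_coprime]
  exact IsUnit.of_pow_eq_one (pow_orderOf_eq_one _) h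

lemma exists_isPrimitiveRoot_of_orderOf {c e : ℕ} (he : e ≠ 0) (ho : orderOf (q : ZMod c) = e) :
    ∃ y : AlgebraicClosure F, IsPrimitiveRoot y c := by
  have hcop := Nat.coprime_of_orderOf_ne_zero (ho.trans_ne he)
  obtain ⟨p, hp⟩ := CharP.exists F
  have hpp := CharP.char_is_prime F p
  have : NeZero (c : AlgebraicClosure F) := ⟨by
    intro h0
    have : (c : F) = 0 := by
      apply (algebraMap F (AlgebraicClosure F)).injective
      simpa using h0
    have h1 := (CharP.cast_eq_zero_iff F p c).1 this
    have h2 := (CharP.cast_eq_zero_iff F p q).1 (Nat.cast_card_eq_zero F)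
    exact hpp.one_lt.ne' (Nat.eq_one_of_dvd_coprimes hcop h2 h1)⟩
  have hc : 0 < c := Nat.pos_of_ne_zero (by rintro rfl; exact NeZero.ne ((0 : ℕ) : AlgebraicClosure F) Nat.cast_zero)
  obtain ⟨y, hy⟩ := IsAlgClosed.exists_root (cyclotomic c (AlgebraicClosure F)) (degree_cyclotomic_pos c (AlgebraicClosure F) hc).ne'
  exact ⟨y, isRoot_cyclotomic_iff.1 hy⟩

variable {y : AlgebraicClosure F} {c e : ℕ} [NeZero c]

lemma IsPrimitiveRoot.pow_card_pow_eq_iff (hy : IsPrimitiveRoot y c) (i j : ℕ) :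
    y ^ q ^ i = y ^ q ^ j ↔ (q : ZMod c) ^ i = (q : ZMod c) ^ j := by
  rw [← Nat.cast_pow, ← Nat.cast_pow, ZMod.natCast_eq_natCast_iff, hy.eq_orderOf]
  exact (isOfFinOrder_iff_pow_eq_one.2
    ⟨c, NeZero.pos c, hy.pow_eq_one⟩).pow_eq_pow_iff_modEq

lemma IsPrimitiveRoot.injOn_frobenius (hy : IsPrimitiveRoot y c) (ho : orderOf (q : ZMod c) = e) :
    Set.InjOn (fun i => y ^ q ^ i) (Finset.range e : Set ℕ) := by
  intro i hi j hj hij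
  subst ho
  simp only [Finset.coe_range] at hi hj
  exact pow_injOn_Iio_orderOf hi hj ((hy.pow_card_pow_eq_iff i j).1 hij)

lemma IsPrimitiveRoot.card_frobeniusOrbit (hy : IsPrimitiveRoot y c)
    (ho : orderOf (q : ZMod c) = e) : (frobeniusOrbit y e).card = e := by
  classical
  rw [frobeniusOrbit, Finset.card_image_of_injOn (hy.injOn_frobenius ho), Finset.card_range]

omit [NeZero c] in
lemma IsPrimitiveRoot.of_mem_frobeniusOrbit (hy : IsPrimitiveRoot y c) (he : e ≠ 0)
    (ho : orderOf (q : ZMod c) = e) {z : AlgebraicClosure F} (hz : z ∈ frobeniusOrbit y e) :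
    IsPrimitiveRoot z c := by
  classical
  obtain ⟨i, -, rfl⟩ := Finset.mem_image.1 hz
  exact hy.pow_of_coprime _ ((Nat.coprime_of_orderOf_ne_zero (ho.trans_ne he)).pow_left i)

lemma IsPrimitiveRoot.natDegree_minpoly_eq_orderOf (hy : IsPrimitiveRoot y c)
    (ho : orderOf (q : ZMod c) = e) : (minpoly F y).natDegree = e := by
  have hirr : Irreducible (minpoly F y) := minpoly.irreducible (Algebra.IsIntegral.isIntegral y)
  have key : ∀ m : ℕ, (minpoly F y).natDegree ∣ m ↔ e ∣ m := by
    intro m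
    rw [hirr.natDegree_dvd_iff_dvd_X_pow_card_pow_sub_X, ← ho, orderOf_dvd_iff_pow_eq_one,
      minpoly.dvd_iff, Nat.card_eq_fintype_card]
    have := hy.pow_card_pow_eq_iff m 0
    simpa [sub_eq_zero] using this
  exact Nat.dvd_antisymm ((key e).2 dvd_rfl) ((key _).1 dvd_rfl)

lemma IsPrimitiveRoot.exists_prod_eq_one {k : ℕ} (hk : k ≠ 0) (hy : IsPrimitiveRoot y c)
    (hc1 : c ≠ 1) (ho : orderOf (q : ZMod c) = 2 * k) (hc : c ∣ q ^ k + 1) {j : ℕ}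
    (hj : j ≤ 2 * k + 1) :
    ∃ s : Finset (AlgebraicClosure F), s.card = j ∧ (∀ x ∈ s, x = 1 ∨ x ∈ frobeniusOrbit y (2 * k)) ∧
      ∏ x ∈ s, x = 1 := by
  classical
  have heven : ∀ t ≤ k, ∃ s : Finset (AlgebraicClosure F), s.card = 2 * t ∧ s ⊆ frobeniusOrbit y (2 * k) ∧
      ∏ x ∈ s, x = 1 := by
    intro t ht
    let I : Finset ℕ := Finset.range t ∪ (Finset.range t).image (k + ·)
    have hdisj : Disjoint (Finset.range t) ((Finset.range t).image (k + ·)) := by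
      rw [Finset.disjoint_left]
      intro a ha hb
      obtain ⟨b, -, rfl⟩ := Finset.mem_image.1 hb
      rw [Finset.mem_range] at ha
      omega
    have hI : I ⊆ Finset.range (2 * k) := by
      intro a ha
      simp only [I, Finset.mem_union, Finset.mem_image, Finset.mem_range] at ha ⊢
      omega
    have hinj : Set.InjOn (fun i => y ^ q ^ i) (I : Set ℕ) :=
      (hy.injOn_frobenius ho).mono (by exact_mod_cast hI)
    have hinj' : Set.InjOn (fun i => k + i) (Finset.range t : Set ℕ) := fun a _ b _ h => by
      simpa using h
    refine ⟨I.image fun i => y ^ q ^ i, ?_, Finset.image_subset_image hI, ?_⟩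
    · rw [Finset.card_image_of_injOn hinj, Finset.card_union_of_disjoint hdisj,
        Finset.card_image_of_injOn hinj', Finset.card_range]
      ring
    · rw [Finset.prod_image hinj, Finset.prod_union hdisj, Finset.prod_image hinj',
        ← Finset.prod_mul_distrib]
      refine Finset.prod_eq_one fun i _ => ?_
      rw [← pow_add, hy.pow_eq_one_iff_dvd]
      refine hc.trans ⟨q ^ i, ?_⟩
      ring
  rcases Nat.even_or_odd' j with ⟨t, rfl | rfl⟩
  · obtain ⟨s, h1, h2, h3⟩ := heven t (by omega)
    exact ⟨s, h1, fun x hx => Or.inr (h2 hx), h3⟩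
  · obtain ⟨s, h1, h2, h3⟩ := heven t (by omega)
    have h1s : (1 : AlgebraicClosure F) ∉ s := fun h => by
      have := hy.of_mem_frobeniusOrbit (by omega) ho (h2 h)
      exact hc1 (this.unique IsPrimitiveRoot.one)
    refine ⟨insert 1 s, by rw [Finset.card_insert_of_notMem h1s, h1], ?_, ?_⟩
    · intro x hx
      rcases Finset.mem_insert.1 hx with h | h
      · exact Or.inl h
      · exact Or.inr (h2 h)
    · rw [Finset.prod_insert h1s, h3, one_mul]

lemma IsPrimitiveRoot.prod_frobeniusOrbit_eq_one (hy : IsPrimitiveRoot y c) (hc : c.Prime)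
    (he : 2 ≤ e) (ho : orderOf (q : ZMod c) = e) : ∏ x ∈ frobeniusOrbit y e, x = 1 := by
  have : Fact c.Prime := ⟨hc⟩
  classical
  rw [frobeniusOrbit, Finset.prod_image (hy.injOn_frobenius ho), Finset.prod_pow_eq_pow_sum,
    hy.pow_eq_one_iff_dvd, ← ZMod.natCast_eq_zero_iff]
  have h1 : (q : ZMod c) - 1 ≠ 0 := by
    intro h
    rw [sub_eq_zero.1 h, orderOf_one] at ho
    omega
  have h2 := geom_sum_mul (q : ZMod c) e
  rw [← ho, pow_orderOf_eq_one, sub_self, ho] at h2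
  push_cast
  exact (mul_eq_zero.1 h2).resolve_right h1

omit [Fintype F] [NeZero c] in
lemma IsPrimitiveRoot.dvd_of_minpoly_dvd (hy : IsPrimitiveRoot y c) {f : F[X]} {N : ℕ}
    (hf : minpoly F y ∣ f) (hN : f ∣ X ^ N - 1) : c ∣ N := by
  have := (minpoly.dvd_iff).1 (hf.trans hN)
  rw [← hy.pow_eq_one_iff_dvd]
  simpa [sub_eq_zero] using this

lemma dvd_pow_add_one_of_orderOf {a l k : ℕ} (hl : l.Prime) (hk : k ≠ 0)
    (ho : orderOf (a : ZMod l) = 2 * k) : l ∣ a ^ k + 1 := by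
  have : Fact l.Prime := ⟨hl⟩
  have h1 : ((a : ZMod l) ^ k) ^ 2 = 1 := by
    rw [← pow_mul, mul_comm, ← ho, pow_orderOf_eq_one]
  rw [← ZMod.natCast_eq_zero_iff]
  rcases eq_or_eq_neg_of_sq_eq_sq _ 1 (h1.trans (one_pow 2).symm) with h | h
  · have := Nat.le_of_dvd (Nat.pos_of_ne_zero hk) (ho ▸ orderOf_dvd_of_pow_eq_one h)
    omega
  · push_cast
    rw [h, neg_add_cancel]

lemma ZMod.orderOf_natCast_add_one {a : ℕ} (ha : 1 < a) : orderOf (a : ZMod (a + 1)) = 2 := by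
  have h : (a : ZMod (a + 1)) = -1 := by
    rw [eq_neg_iff_add_eq_zero]
    exact_mod_cast ZMod.natCast_self (a + 1)
  refine orderOf_eq_prime (by rw [h]; ring) fun h1 => ?_
  have h2 : (a : ZMod (a + 1)) = (1 : ℕ) := by simpa using h1
  rw [ZMod.natCast_eq_natCast_iff', Nat.mod_eq_of_lt (by omega), Nat.mod_eq_of_lt (by omega)] at h2
  omega

omit [Fintype F] in
lemma natDegree_X_sub_one_mul {f : F[X]} (hf : f.Monic) :
    ((X - 1) * f).natDegree = f.natDegree + 1 := by
  rw [← C_1, (monic_X_sub_C 1).natDegree_mul hf, natDegree_X_sub_C, add_comm]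

/-- The conclusion of the main theorem, with all primes dividing `q` in place of `p`. -/
def HasRegularSemisimpleElement (F : Type*) [Field F] [Fintype F] (n : ℕ) : Prop :=
  ∃ g : Matrix.SpecialLinearGroup (Fin n) F,
    Nat.Coprime (orderOf g) (Fintype.card F) ∧
    (∀ p : ℕ, p.Prime → p ∣ Fintype.card F →
      ¬ ∃ h : Matrix.SpecialLinearGroup (Fin n) F, orderOf h = p * orderOf g) ∧
    Subgroup.zpowers g ⊓ Subgroup.center (Matrix.SpecialLinearGroup (Fin n) F) = ⊥ ∧
    ∀ j : ℕ, j ≤ n → ∃ s : Finset (AlgebraicClosure F),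
      s.card = j ∧
      (∀ x ∈ s, aeval x (Matrix.charpoly (g : Matrix (Fin n) (Fin n) F)) = 0) ∧
      ∏ x ∈ s, x = 1

lemma hasRegularSemisimpleElement_of_odd {n k : ℕ} (hq : 3 < q) (hk : 2 ≤ k) (hn : n = 2 * k + 1) :
    HasRegularSemisimpleElement F n := by
  classical
  obtain ⟨l, hl, ho⟩ := exists_prime_orderOf_eq (e := 2 * k) (show 4 ≤ q by omega) (by omega)
  have : NeZero l := ⟨hl.ne_zero⟩
  obtain ⟨y, hy⟩ := exists_isPrimitiveRoot_of_orderOf (F := F) (by omega) ho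
  have hmon := minpoly.monic (Algebra.IsIntegral.isIntegral (R := F) y)
  refine exists_SL_of_charpoly (r := l) (f := (X - 1) * minpoly F y)
    ((monic_X_sub_C 1).mul hmon) ?_ (by simp) ?_
    (fun N hN => hy.dvd_of_minpoly_dvd (dvd_mul_left _ _) hN)
    fun h hlh => SL_orderOf_coprime_of_nodup h
      (nodup_of_prime_dvd_orderOf h hl (by omega) hn ho hlh)
  · rw [natDegree_X_sub_one_mul hmon, hy.natDegree_minpoly_eq_orderOf ho, hn]
  · intro j hj
    obtain ⟨s, hs, hroot, hprod⟩ := hy.exists_prod_eq_one (by omega) hl.ne_one ho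
      (dvd_pow_add_one_of_orderOf hl (by omega) ho) (hn ▸ hj)
    refine ⟨s, hs, fun x hx => ?_, hprod⟩
    rcases hroot x hx with rfl | h
    · simp
    · simp [aeval_minpoly_of_mem_frobeniusOrbit h]

lemma hasRegularSemisimpleElement_of_even {n k d l : ℕ} (hk : k ≠ 0) (hd : 2 ≤ d)
    (hne : d ≠ 2 * k) (hdk : d ≤ 2 * k + 1) (hn : n = d + 2 * k + 1) (hc1 : c ≠ 1)
    (ho : orderOf (q : ZMod c) = 2 * k) (hck : c ∣ q ^ k + 1) (hl : l.Prime)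
    (hol : orderOf (q : ZMod l) = d)
    (hmax : ∀ h : Matrix.SpecialLinearGroup (Fin n) F, c ∣ orderOf h → l ∣ orderOf h →
      (orderOf h).Coprime q) :
    HasRegularSemisimpleElement F n := by
  classical
  have : NeZero l := ⟨hl.ne_zero⟩
  obtain ⟨y, hy⟩ := exists_isPrimitiveRoot_of_orderOf (F := F) (by omega) ho
  obtain ⟨x, hx⟩ := exists_isPrimitiveRoot_of_orderOf (F := F) (by omega) hol
  have hmy := minpoly.monic (Algebra.IsIntegral.isIntegral (R := F) y)
  have hmx := minpoly.monic (Algebra.IsIntegral.isIntegral (R := F) x)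
  refine exists_SL_of_charpoly (r := Nat.lcm c l) (f := (X - 1) * (minpoly F y * minpoly F x))
    ((monic_X_sub_C 1).mul (hmy.mul hmx)) ?_ (by simp) ?_
    (fun N hN => Nat.lcm_dvd
      (hy.dvd_of_minpoly_dvd (Dvd.intro _ rfl |>.trans (dvd_mul_left _ _)) hN)
      (hx.dvd_of_minpoly_dvd (Dvd.intro_left _ rfl |>.trans (dvd_mul_left _ _)) hN))
    fun h hlh => hmax h ((Nat.dvd_lcm_left c l).trans hlh) ((Nat.dvd_lcm_right c l).trans hlh)
  · rw [natDegree_X_sub_one_mul (hmy.mul hmx), hmy.natDegree_mul hmx,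
      hy.natDegree_minpoly_eq_orderOf ho, hx.natDegree_minpoly_eq_orderOf hol, hn]
    ring
  · intro j hj
    by_cases hjk : j ≤ 2 * k + 1
    · obtain ⟨s, hs, hroot, hprod⟩ := hy.exists_prod_eq_one hk hc1 ho hck hjk
      refine ⟨s, hs, fun z hz => ?_, hprod⟩
      rcases hroot z hz with rfl | h
      · simp
      · simp [aeval_minpoly_of_mem_frobeniusOrbit h]
    · obtain ⟨s, hs, hroot, hprod⟩ := hy.exists_prod_eq_one (j := j - d) hk hc1 ho hck (by omega)
      have hdisj : Disjoint s (frobeniusOrbit x d) := by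
        rw [Finset.disjoint_left]
        intro z hz hzx
        have hzl := hx.of_mem_frobeniusOrbit (by omega) hol hzx
        rcases hroot z hz with rfl | h
        · exact hl.ne_one (hzl.unique IsPrimitiveRoot.one)
        · have hzc := hy.of_mem_frobeniusOrbit (by omega) ho h
          obtain rfl := hzl.unique hzc
          exact hne (hol.symm.trans ho)
      refine ⟨s ∪ frobeniusOrbit x d, ?_, fun z hz => ?_, ?_⟩
      · rw [Finset.card_union_of_disjoint hdisj, hs, hx.card_frobeniusOrbit hol]
        omega
      · rcases Finset.mem_union.1 hz with hz | hz
        · rcases hroot z hz with rfl | h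
          · simp
          · simp [aeval_minpoly_of_mem_frobeniusOrbit h]
        · simp [aeval_minpoly_of_mem_frobeniusOrbit hz]
      · rw [Finset.prod_union hdisj, hprod, hx.prod_frobeniusOrbit_eq_one hl hd hol, one_mul]

lemma hasRegularSemisimpleElement_six (hq : 3 < q) : HasRegularSemisimpleElement F 6 := by
  classical
  obtain ⟨l, hl, ho⟩ := exists_prime_orderOf_eq (show 4 ≤ q by omega) (le_refl 3)
  refine hasRegularSemisimpleElement_of_even (k := 1) (c := q + 1) one_ne_zero (by omega)
    (by omega) le_rfl rfl (by omega) (ZMod.orderOf_natCast_add_one (by omega)) (by simp) hl ho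
    fun h h1 h2 => SL_orderOf_coprime_of_nodup h (nodup_of_dvd_orderOf_six h hq hl ho h2 h1)

lemma hasRegularSemisimpleElement_of_coprime {n k d : ℕ} (hq : 3 < q) (hk : 2 ≤ k) (hd : 3 ≤ d)
    (hcop : d.Coprime (2 * k)) (hdk : d ≤ 2 * k + 1) (hn : n = d + 2 * k + 1) :
    HasRegularSemisimpleElement F n := by
  classical
  obtain ⟨l, hl, ho⟩ := exists_prime_orderOf_eq (show 4 ≤ q by omega) hd
  obtain ⟨c, hc, hoc⟩ := exists_prime_orderOf_eq (e := 2 * k) (show 4 ≤ q by omega) (by omega)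
  have : NeZero c := ⟨hc.ne_zero⟩
  refine hasRegularSemisimpleElement_of_even (by omega) (by omega) ?_ hdk hn hc.ne_one hoc
    (dvd_pow_add_one_of_orderOf hc (by omega) hoc) hl ho
    fun h h1 h2 => SL_orderOf_coprime_of_nodup h
      (nodup_of_primes_dvd_orderOf h hl hc hd (by omega) hcop hn ho hoc h2 h1)
  rintro rfl
  rw [Nat.coprime_self] at hcop
  omega

lemma hasRegularSemisimpleElement {n : ℕ} (hq : 3 < q) (hn : 5 ≤ n) :
    HasRegularSemisimpleElement F n := by
  rcases Nat.even_or_odd' n with ⟨m, rfl | rfl⟩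
  · by_cases hm : m = 3
    · subst hm
      exact hasRegularSemisimpleElement_six hq
    rcases Nat.even_or_odd' m with ⟨t, rfl | rfl⟩
    · refine hasRegularSemisimpleElement_of_coprime (k := t) (d := 2 * t - 1) hq (by omega)
        (by omega) ?_ (by omega) (by omega)
      obtain ⟨u, hu⟩ : ∃ u, 2 * t = u + 1 := ⟨2 * t - 1, by omega⟩
      rw [hu]
      simp
    · refine hasRegularSemisimpleElement_of_coprime (k := t) (d := 2 * t + 1) hq (by omega)
        (by omega) (by simp) (by omega) (by omega)
  · exact hasRegularSemisimpleElement_of_odd hq (by omega) rfl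

end Construction

/-- For `q = p^m > 3` and `n ≥ 5`, the group `S = SL_n(F_q)` contains a semisimple element
`g` of `p`-maximal order with `⟨g⟩ ∩ Z(S) = 1` such that, for every `0 ≤ j ≤ n`, some `j`
pairwise distinct characteristic values of `g` have product `1`. -/
theorem SL_exists_semisimple_pMaximal (p m q n : ℕ) (hp : p.Prime) (hm : 0 < m)
    (hq : q = p ^ m) (hq3 : 3 < q) (hn : 5 ≤ n)
    (F : Type*) [Field F] [Fintype F] (hF : Fintype.card F = q) :
    ∃ g : Matrix.SpecialLinearGroup (Fin n) F,
      Nat.Coprime (orderOf g) p ∧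
      (¬ ∃ h : Matrix.SpecialLinearGroup (Fin n) F, orderOf h = p * orderOf g) ∧
      Subgroup.zpowers g ⊓ Subgroup.center (Matrix.SpecialLinearGroup (Fin n) F) = ⊥ ∧
      ∀ j : ℕ, j ≤ n → ∃ s : Finset (AlgebraicClosure F),
        s.card = j ∧
        (∀ x ∈ s, Polynomial.aeval x
          (Matrix.charpoly (g : Matrix (Fin n) (Fin n) F)) = 0) ∧
        ∏ x ∈ s, x = 1 := by
  obtain ⟨g, h1, h2, h3, h4⟩ := hasRegularSemisimpleElement (F := F) (hF ▸ hq3) hn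
  have hpq : p ∣ Fintype.card F := hF ▸ hq ▸ dvd_pow_self p hm.ne'
  exact ⟨g, h1.coprime_dvd_right hpq, h2 p hp hpq, h3, h4⟩
end
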